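/- The closed subspace L(α) of B(α) is stable under the action of GL₂(ℚ_p); likewise, L(β) is stable under the action of GL₂(ℚ_p) on B(β). -/

import Mathlib

open Filter Topology Classical

noncomputable section

namespace Paper

variable (p : ℕ) [Fact p.Prime]
variable (L : Type) [NontriviallyNormedField L] [NormedAlgebra ℚ_[p] L]

/-- The canonical embedding `ℚ_p → L`. -/
noncomputable def iotaL : ℚ_[p] → L := algebraMap ℚ_[p] L

/-- The binomial coefficient `binom(z, n) = z(z-1)⋯(z-n+1)/n!` of a `p`-adic
integer, computed in `ℚ_p`. -/
noncomputable def binomQ (z : ℤ_[p]) (n : ℕ) : ℚ_[p] :=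
  (∏ i ∈ Finset.range n, ((z : ℚ_[p]) - (i : ℚ_[p]))) / (n.factorial : ℚ_[p])

/-- The Mahler coefficients `a_n(f) = ∑_{i=0}^n (-1)^i binom(n,i) f(n-i)`. -/
noncomputable def mahlerCoeff (f : ℤ_[p] → L) (n : ℕ) : L :=
  ∑ i ∈ Finset.range (n + 1), (-1 : L) ^ i * (n.choose i : L) * f (((n - i : ℕ) : ℤ_[p]))

/-- `f : ℤ_p → L` is of class `C^r` : the scaled Mahler coefficients
`n^r a_n(f)` tend to `0`, and `f` is the sum of its Mahler expansion. -/
def IsCr (r : ℝ) (f : ℤ_[p] → L) : Prop :=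
  Tendsto (fun n : ℕ => (n : ℝ) ^ r * ‖mahlerCoeff p L f n‖) atTop (nhds 0) ∧
  ∀ z : ℤ_[p], HasSum (fun n : ℕ => mahlerCoeff p L f n * iotaL p L (binomQ p z n)) (f z)

/-- The norm `‖f‖_r = sup_n (n+1)^r ‖a_n(f)‖` on `C^r(ℤ_p, L)`. -/
noncomputable def crNorm (r : ℝ) (f : ℤ_[p] → L) : ℝ :=
  ⨆ n : ℕ, ((n : ℝ) + 1) ^ r * ‖mahlerCoeff p L f n‖

/-- A continuous (= bounded) linear functional on `C^r(ℤ_p, L)`, i.e. a tempered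
distribution of order `r`. -/
structure CrDual (r : ℝ) where
  toFun : (ℤ_[p] → L) → L
  map_add' : ∀ f g : ℤ_[p] → L, IsCr p L r f → IsCr p L r g →
    toFun (f + g) = toFun f + toFun g
  map_smul' : ∀ (c : L) (f : ℤ_[p] → L), IsCr p L r f → toFun (c • f) = c * toFun f
  bound' : ∃ C : ℝ, ∀ f : ℤ_[p] → L, IsCr p L r f → ‖toFun f‖ ≤ C * crNorm p L r f

/-- The function `z ↦ 1_{a + pⁿℤ_p}(z) (z - a)^j`. -/
noncomputable def indPoly (a : ℤ_[p]) (n : ℕ) (j : ℕ) : ℤ_[p] → L := fun z =>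
  if ‖z - a‖ ≤ (p : ℝ) ^ (-(n : ℤ)) then (iotaL p L ((z : ℚ_[p]) - (a : ℚ_[p]))) ^ j else 0

/-- The norm `‖μ‖_{r,d} = sup_{a, 0 ≤ j ≤ d, n} p^{n(j-r)} ‖∫_{a+pⁿℤ_p} (z-a)^j dμ‖`. -/
noncomputable def dualNormRD (r : ℝ) (d : ℕ) (μ : CrDual p L r) : ℝ :=
  ⨆ (a : ℤ_[p]) (j : Fin (d + 1)) (n : ℕ),
    (p : ℝ) ^ ((n : ℝ) * (((j : ℕ) : ℝ) - r)) * ‖μ.toFun (indPoly p L a n j)‖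

/-- `f : ℤ_p → L` is locally polynomial of local degree at most `d`. -/
def IsLocPoly (d : ℕ) (f : ℤ_[p] → L) : Prop :=
  ∃ n : ℕ, ∀ a : ℤ_[p], ∃ P : Polynomial L, P.natDegree ≤ d ∧
    ∀ z : ℤ_[p], ‖z - a‖ ≤ (p : ℝ) ^ (-(n : ℤ)) → f z = Polynomial.eval (iotaL p L (z : ℚ_[p])) P

/-- A linear functional on `Pol^d(ℤ_p, L)`. -/
structure PolDual (d : ℕ) where
  toFun : (ℤ_[p] → L) → L
  map_add' : ∀ f g : ℤ_[p] → L, IsLocPoly p L d f → IsLocPoly p L d g →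
    toFun (f + g) = toFun f + toFun g
  map_smul' : ∀ (c : L) (f : ℤ_[p] → L), IsLocPoly p L d f → toFun (c • f) = c * toFun f

/-- The valuation `val(x) = -log_p ‖x‖` on `L`, normalized by `val(p) = 1`. -/
noncomputable def valL (x : L) : ℝ := -Real.logb p ‖x‖

/-- `g : ℤ_p → L` is a class-`C^{val α}` extension of
`z ↦ (αp/β)^{val z} z^{k-2} f(1/z)` from `ℤ_p ∖ {0}` to `ℤ_p`. -/
def Ext2 (k : ℕ) (α β : L) (f : ℚ_[p] → L) (g : ℤ_[p] → L) : Prop :=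
  IsCr p L (valL p L α) g ∧ ∀ z : ℤ_[p], z ≠ 0 →
    g z = (α * (p : L) / β) ^ ((z : ℚ_[p]).valuation) *
      (iotaL p L (z : ℚ_[p])) ^ (k - 2) * f (((z : ℚ_[p]))⁻¹)

/-- Membership in the Banach space `B(α)`. -/
def MemB (k : ℕ) (α β : L) (f : ℚ_[p] → L) : Prop :=
  IsCr p L (valL p L α) (fun z : ℤ_[p] => f ((p : ℚ_[p]) * (z : ℚ_[p]))) ∧
  ∃ g : ℤ_[p] → L, Ext2 p L k α β f g

/-- The extension `f₂` of `z ↦ (αp/β)^{val z} z^{k-2} f(1/z)` to `ℤ_p`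
(it is unique when it exists). -/
noncomputable def ext2 (k : ℕ) (α β : L) (f : ℚ_[p] → L) : ℤ_[p] → L :=
  if h : ∃ g : ℤ_[p] → L, Ext2 p L k α β f g then h.choose else 0

/-- The norm `‖f‖ = max(‖f₁‖_{val α}, ‖f₂‖_{val α})` on `B(α)`. -/
noncomputable def bNorm (k : ℕ) (α β : L) (f : ℚ_[p] → L) : ℝ :=
  max (crNorm p L (valL p L α) (fun z : ℤ_[p] => f ((p : ℚ_[p]) * (z : ℚ_[p]))))
      (crNorm p L (valL p L α) (ext2 p L k α β f))

/-- Determinant of a 2×2 matrix. -/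
noncomputable def det2 (m : Matrix (Fin 2) (Fin 2) ℚ_[p]) : ℚ_[p] :=
  m 0 0 * m 1 1 - m 0 1 * m 1 0

/-- The action of `g = (a b; c d) ∈ GL₂(ℚ_p)` on `B(α)`:
`(g·f)(z) = α^{-val(ad-bc)} (αp/β)^{val(-cz+a)} (-cz+a)^{k-2} f((dz-b)/(-cz+a))`,
the value at the pole `-cz+a = 0` being the one prescribed by the extension `f₂`. -/
noncomputable def gAct (k : ℕ) (α β : L) (m : Matrix (Fin 2) (Fin 2) ℚ_[p])
    (f : ℚ_[p] → L) : ℚ_[p] → L := fun z =>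
  if -(m 1 0) * z + m 0 0 = 0 then
    α ^ (-(det2 p m).valuation) * (α * (p : L) / β) ^ ((det2 p m / m 1 0).valuation) *
      (iotaL p L (det2 p m / m 1 0)) ^ (k - 2) * ext2 p L k α β f 0
  else
    α ^ (-(det2 p m).valuation) * (α * (p : L) / β) ^ ((-(m 1 0) * z + m 0 0).valuation) *
      (iotaL p L (-(m 1 0) * z + m 0 0)) ^ (k - 2) *
      f ((m 1 1 * z - m 0 1) / (-(m 1 0) * z + m 0 0))

/-- The monomial function `z ↦ z^j` on `ℚ_p`. -/
noncomputable def monomialFun (j : ℕ) : ℚ_[p] → L := fun z => (iotaL p L z) ^ j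

/-- The function `z ↦ (αp/β)^{val(z-a)} (z-a)^{k-2-j}` (extended by `0` at `z = a`). -/
noncomputable def specFun (k : ℕ) (α β : L) (a : ℚ_[p]) (j : ℕ) : ℚ_[p] → L := fun z =>
  if z = a then 0 else
    (α * (p : L) / β) ^ ((z - a).valuation) * (iotaL p L (z - a)) ^ (k - 2 - j)

/-- The generators of `L(α)` : the functions `z^j` and
`(αp/β)^{val(z-a)}(z-a)^{k-2-j}` for `0 ≤ j < val(α)` and `a ∈ ℚ_p`. -/
def lGen (k : ℕ) (α β : L) : Set (ℚ_[p] → L) :=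
  {f | ∃ j : ℕ, (j : ℝ) < valL p L α ∧
    (f = monomialFun p L j ∨ ∃ a : ℚ_[p], f = specFun p L k α β a j)}

/-- Membership in `L(α)`, the closure in `B(α)` of the span of the special
functions. -/
def MemLalpha (k : ℕ) (α β : L) (f : ℚ_[p] → L) : Prop :=
  MemB p L k α β f ∧ ∀ ε : ℝ, 0 < ε →
    ∃ g ∈ Submodule.span L (lGen p L k α β), bNorm p L k α β (f - g) < ε

/-- The quotient (semi)norm on `Π(V) = B(α)/L(α)`. -/
noncomputable def qNorm (k : ℕ) (α β : L) (f : ℚ_[p] → L) : ℝ :=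
  sInf {x : ℝ | ∃ g : ℚ_[p] → L, MemLalpha p L k α β g ∧ x = bNorm p L k α β (f - g)}

/-- `h : ℚ_p → L` is locally constant. -/
def LocConst (h : ℚ_[p] → L) : Prop :=
  ∀ x : ℚ_[p], ∃ n : ℕ, ∀ y : ℚ_[p], ‖y - x‖ ≤ (p : ℝ) ^ (-(n : ℤ)) → h y = h x

/-- `h` belongs to the smooth induced representation: `h` is locally constant and
`z ↦ (αp/β)^{val z} h(1/z)` extends to a locally constant function on `ℚ_p`. -/
def IndCond (α β : L) (h : ℚ_[p] → L) : Prop :=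
  LocConst p L h ∧ ∃ h' : ℚ_[p] → L, LocConst p L h' ∧
    ∀ z : ℚ_[p], z ≠ 0 → h' z = (α * (p : L) / β) ^ z.valuation * h z⁻¹

/-- The generators `z ↦ P(z) h(z)` of the locally algebraic representation `π(α)`. -/
def piGen (k : ℕ) (α β : L) : Set (ℚ_[p] → L) :=
  {f | ∃ (P : Polynomial L) (h : ℚ_[p] → L), P.natDegree ≤ k - 2 ∧ IndCond p L α β h ∧
    f = fun z => Polynomial.eval (iotaL p L z) P * h z}

/-- The locally algebraic representation `π(α)`, as a subspace of functions
`ℚ_p → L`. -/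
noncomputable def piRep (k : ℕ) (α β : L) : Submodule L (ℚ_[p] → L) :=
  Submodule.span L (piGen p L k α β)

/-- The standing hypotheses on `(k, α, β)` coming from an absolutely irreducible,
`φ`-semisimple crystalline representation: `k ≥ 2`, `α ≠ β`,
`0 < val(β) ≤ val(α)` and `val(α) + val(β) = k - 1`. -/
def Hyps (k : ℕ) (α β : L) : Prop :=
  2 ≤ k ∧ α ≠ β ∧ 0 < valL p L α ∧ 0 < valL p L β ∧
    valL p L α + valL p L β = (k : ℝ) - 1 ∧ valL p L β ≤ valL p L α

/-- `Λ` is a `GL₂(ℚ_p)`-stable `𝒪_L`-lattice in `π(α)`: an `𝒪_L`-submodule of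
`π(α)` generating it over `L`, containing no `L`-line and stable by the action. -/
def IsLatticeStable (k : ℕ) (α β : L) (Λ : Set (ℚ_[p] → L)) : Prop :=
  (∀ f ∈ Λ, f ∈ piRep p L k α β) ∧ ((0 : ℚ_[p] → L) ∈ Λ) ∧
  (∀ f ∈ Λ, ∀ g ∈ Λ, f + g ∈ Λ) ∧
  (∀ c : L, ‖c‖ ≤ 1 → ∀ f ∈ Λ, c • f ∈ Λ) ∧
  (∀ f ∈ piRep p L k α β, ∃ c : L, c ≠ 0 ∧ c • f ∈ Λ) ∧
  (∀ f, f ∈ piRep p L k α β → f ≠ 0 → ¬ ∀ c : L, c • f ∈ Λ) ∧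
  (∀ m : Matrix (Fin 2) (Fin 2) ℚ_[p], det2 p m ≠ 0 → ∀ f ∈ Λ, gAct p L k α β m f ∈ Λ)

section LocalPolynomials

variable {p : ℕ} [Fact p.Prime]

/-- The condition `‖coeff Q s‖ ≤ R ^ s` on the coefficients of a polynomial: every monomial is
bounded by `1` on the disc of radius `R⁻¹`. -/
def CoeffBound (R : ℝ) (Q : Polynomial ℚ_[p]) : Prop :=
  ∀ s : ℕ, ‖Q.coeff s‖ ≤ R ^ s

lemma CoeffBound.one {R : ℝ} (hR : 0 ≤ R) : CoeffBound R (1 : Polynomial ℚ_[p]) := by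
  intro s
  rw [Polynomial.coeff_one]
  split_ifs with h
  · simp [h]
  · simpa using pow_nonneg hR s

lemma CoeffBound.mul {R : ℝ} (hR : 0 ≤ R) {P Q : Polynomial ℚ_[p]} (hP : CoeffBound R P)
    (hQ : CoeffBound R Q) : CoeffBound R (P * Q) := by
  intro s
  rw [Polynomial.coeff_mul]
  refine IsUltrametricDist.norm_sum_le_of_forall_le_of_nonneg (pow_nonneg hR s) fun x hx ↦ ?_
  rw [norm_mul, ← Finset.HasAntidiagonal.mem_antidiagonal.mp hx, pow_add]
  exact mul_le_mul (hP _) (hQ _) (norm_nonneg _) (pow_nonneg hR _)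

lemma CoeffBound.prod {ι : Type*} {R : ℝ} (hR : 0 ≤ R) (s : Finset ι)
    (P : ι → Polynomial ℚ_[p]) (hP : ∀ i ∈ s, CoeffBound R (P i)) :
    CoeffBound R (∏ i ∈ s, P i) :=
  Finset.prod_induction P (CoeffBound R) (fun _ _ ↦ CoeffBound.mul hR) (CoeffBound.one hR) hP

lemma CoeffBound.sum {ι : Type*} {R : ℝ} (hR : 0 ≤ R) (s : Finset ι)
    (P : ι → Polynomial ℚ_[p]) (hP : ∀ i ∈ s, CoeffBound R (P i)) :
    CoeffBound R (∑ i ∈ s, P i) := by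
  intro n
  rw [Polynomial.finsetSum_coeff]
  exact IsUltrametricDist.norm_sum_le_of_forall_le_of_nonneg (pow_nonneg hR n)
    fun i hi ↦ hP i hi n

lemma CoeffBound.linear {R : ℝ} (hR : 0 ≤ R) {u c : ℚ_[p]} (hu : ‖u‖ ≤ 1) (hc : ‖c‖ ≤ R) :
    CoeffBound R (Polynomial.C c * Polynomial.X + Polynomial.C u) := by
  intro s
  match s with
  | 0 => simpa using hu
  | 1 => simpa [Polynomial.coeff_C] using hc
  | s + 2 =>
    have : (Polynomial.C c * Polynomial.X + Polynomial.C u).coeff (s + 2) = 0 := by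
      simp
    rw [this, norm_zero]
    exact pow_nonneg hR _

lemma CoeffBound.C {R : ℝ} (hR : 0 ≤ R) {u : ℚ_[p]} (hu : ‖u‖ ≤ 1) :
    CoeffBound R (Polynomial.C u) := by
  simpa using CoeffBound.linear hR hu (c := 0) (by simpa using hR)

/-- A polynomial with bounded coefficients is close to its truncation in degrees `≤ d` on a small
disc. -/
lemma CoeffBound.exists_truncation {R : ℝ} (hR : 0 ≤ R) {Q : Polynomial ℚ_[p]}
    (hQ : CoeffBound R Q) (d : ℕ) :
    ∃ P : Polynomial ℚ_[p], P.natDegree ≤ d ∧ ∀ (y : ℚ_[p]) (δ : ℝ), ‖y‖ ≤ δ → R * δ ≤ 1 →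
      ‖Q.eval y - P.eval y‖ ≤ (R * δ) ^ (d + 1) := by
  refine ⟨∑ s ∈ Finset.range (d + 1), Polynomial.C (Q.coeff s) * Polynomial.X ^ s, ?_, ?_⟩
  · refine Polynomial.natDegree_sum_le_of_forall_le _ _ fun s hs ↦ ?_
    exact (Polynomial.natDegree_C_mul_X_pow_le _ _).trans (by simpa [Nat.lt_succ_iff] using hs)
  · intro y δ hy hδ
    have hδ0 : 0 ≤ δ := (norm_nonneg _).trans hy
    have h0 : 0 ≤ R * δ := mul_nonneg hR hδ0
    set N := max (Q.natDegree + 1) (d + 1) with hN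
    have h1 : Q.eval y = ∑ s ∈ Finset.range N, Q.coeff s * y ^ s :=
      Polynomial.eval_eq_sum_range' (lt_of_lt_of_le (Nat.lt_succ_self _) (le_max_left _ _)) y
    have h2 := Finset.sum_range_add_sum_Ico (fun s ↦ Q.coeff s * y ^ s)
      (le_max_right (Q.natDegree + 1) (d + 1))
    rw [h1, Polynomial.eval_finsetSum, ← hN] at *
    simp only [Polynomial.eval_mul, Polynomial.eval_C, Polynomial.eval_pow, Polynomial.eval_X]
    rw [← h2, add_sub_cancel_left]
    refine IsUltrametricDist.norm_sum_le_of_forall_le_of_nonneg (pow_nonneg h0 _) fun s hs ↦ ?_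
    rw [norm_mul, norm_pow]
    calc ‖Q.coeff s‖ * ‖y‖ ^ s ≤ R ^ s * δ ^ s :=
          mul_le_mul (hQ s) (pow_le_pow_left₀ (norm_nonneg _) hy _) (by positivity)
            (pow_nonneg hR _)
      _ = (R * δ) ^ s := (mul_pow _ _ _).symm
      _ ≤ (R * δ) ^ (d + 1) := pow_le_pow_of_le_one h0 hδ (Finset.mem_Ico.mp hs).1

variable (p) in
lemma coe_choose_eq_binomQ (z : ℤ_[p]) (n : ℕ) :
    ((Ring.choose z n : ℤ_[p]) : ℚ_[p]) = binomQ p z n := by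
  have h := Ring.descPochhammer_eq_factorial_smul_choose z n
  rw [← Polynomial.aeval_eq_smeval, Polynomial.aeval_def, Polynomial.eval₂_eq_eval_map,
    descPochhammer_map, descPochhammer_eval_eq_prod_range] at h
  have hn : (n.factorial : ℚ_[p]) ≠ 0 := by exact_mod_cast n.factorial_ne_zero
  rw [binomQ, eq_div_iff hn, mul_comm]
  have h' := congrArg (fun x : ℤ_[p] ↦ (x : ℚ_[p])) h
  simp only [nsmul_eq_mul, PadicInt.coe_mul, PadicInt.coe_natCast] at h'
  rw [← h']
  exact map_prod (PadicInt.Coe.ringHom (p := p)) (fun i : ℕ ↦ z - (i : ℤ_[p])) (Finset.range n)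

lemma norm_binomQ_le_one (z : ℤ_[p]) (n : ℕ) : ‖binomQ p z n‖ ≤ 1 := by
  rw [← coe_choose_eq_binomQ]
  exact PadicInt.norm_le_one _

lemma binomQ_add (a y : ℤ_[p]) (n : ℕ) :
    binomQ p (a + y) n = ∑ ij ∈ Finset.HasAntidiagonal.antidiagonal n,
      binomQ p a ij.1 * binomQ p y ij.2 := by
  simp only [← coe_choose_eq_binomQ]
  rw [Ring.add_choose_eq n (Commute.all a y)]
  exact map_sum (PadicInt.Coe.ringHom (p := p)) _ _

lemma norm_inv_natCast_le {n m : ℕ} (hm : m ≠ 0) (hmn : m ≤ n) :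
    ‖((m : ℚ_[p])⁻¹)‖ ≤ (p : ℝ) ^ Nat.log p n := by
  have hp : 1 < (p : ℝ) := by exact_mod_cast (Fact.out : p.Prime).one_lt
  rw [norm_inv, Padic.norm_eq_zpow_neg_valuation (by exact_mod_cast hm), Padic.valuation_natCast,
    zpow_neg, inv_inv, zpow_natCast]
  refine pow_le_pow_right₀ hp.le ?_
  exact (padicValNat_le_nat_log m).trans (Nat.log_mono_right hmn)

/-- `binom(y, i)` is a polynomial in `y` whose coefficients are controlled by `log_p i`. -/
lemma exists_polynomial_binomQ {i n : ℕ} (hin : i ≤ n) :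
    ∃ Q : Polynomial ℚ_[p], CoeffBound ((p : ℝ) ^ Nat.log p n) Q ∧
      ∀ y : ℤ_[p], binomQ p y i = Q.eval (y : ℚ_[p]) := by
  have hR : 0 ≤ (p : ℝ) ^ Nat.log p n := by positivity
  cases i with
  | zero => exact ⟨1, CoeffBound.one hR, fun y ↦ by simp [binomQ]⟩
  | succ i =>
    refine ⟨(Polynomial.C (((i + 1 : ℕ) : ℚ_[p])⁻¹) * Polynomial.X + Polynomial.C 0) *
      ∏ t ∈ Finset.range i,
        (Polynomial.C (((t + 1 : ℕ) : ℚ_[p])⁻¹) * Polynomial.X + Polynomial.C (-1)), ?_, ?_⟩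
    · refine CoeffBound.mul hR (CoeffBound.linear hR (by simp)
        (norm_inv_natCast_le i.succ_ne_zero hin)) (CoeffBound.prod hR _ _ fun t ht ↦ ?_)
      refine CoeffBound.linear hR (by simp) (norm_inv_natCast_le t.succ_ne_zero ?_)
      have := Finset.mem_range.mp ht
      lia
    · intro y
      rw [Polynomial.eval_mul, Polynomial.eval_prod]
      simp only [Polynomial.eval_add, Polynomial.eval_mul, Polynomial.eval_C, Polynomial.eval_X,
        add_zero]
      have h1 : ∀ t : ℕ, ((t + 1 : ℕ) : ℚ_[p])⁻¹ * (y : ℚ_[p]) + -1 =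
          ((y : ℚ_[p]) - ((t + 1 : ℕ) : ℚ_[p])) / ((t + 1 : ℕ) : ℚ_[p]) := by
        intro t
        have : ((t + 1 : ℕ) : ℚ_[p]) ≠ 0 := by exact_mod_cast t.succ_ne_zero
        field_simp
        ring
      simp only [h1]
      rw [Finset.prod_div_distrib, binomQ, Finset.prod_range_succ', Nat.factorial_succ,
        ← Nat.cast_prod (f := fun t ↦ t + 1), Finset.prod_range_add_one_eq_factorial]
      have h2 : ((i + 1 : ℕ) : ℚ_[p]) ≠ 0 := by exact_mod_cast i.succ_ne_zero
      have h3 : (i.factorial : ℚ_[p]) ≠ 0 := by exact_mod_cast i.factorial_ne_zero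
      push_cast at *
      field_simp
      ring

/-- On the ball of radius `p^{-h}` around `a`, `binom(z, n)` is close to a polynomial of degree
at most `d`. -/
lemma exists_polynomial_near_binomQ (d : ℕ) (a : ℤ_[p]) {n h : ℕ} (hn : Nat.log p n ≤ h) :
    ∃ P : Polynomial ℚ_[p], P.natDegree ≤ d ∧ ∀ z : ℤ_[p], ‖z - a‖ ≤ (p : ℝ)⁻¹ ^ h →
      ‖binomQ p z n - P.eval (z : ℚ_[p])‖ ≤ ((p : ℝ)⁻¹ ^ (d + 1)) ^ (h - Nat.log p n) := by
  have hp : 1 < (p : ℝ) := by exact_mod_cast (Fact.out : p.Prime).one_lt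
  have hR : 0 ≤ (p : ℝ) ^ Nat.log p n := by positivity
  choose! Q hQ hQe using fun (i : ℕ) (hi : i ≤ n) ↦ exists_polynomial_binomQ (p := p) hi
  obtain ⟨P, hPd, hP⟩ := CoeffBound.exists_truncation hR
    (Q := ∑ ij ∈ Finset.HasAntidiagonal.antidiagonal n, Polynomial.C (binomQ p a ij.1) * Q ij.2)
    (CoeffBound.sum hR _ _ fun ij hij ↦ CoeffBound.mul hR
      (CoeffBound.C hR (norm_binomQ_le_one _ _))
      (hQ _ (Finset.HasAntidiagonal.antidiagonal.snd_le hij))) d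
  refine ⟨P.comp (Polynomial.X - Polynomial.C (a : ℚ_[p])), ?_, fun z hz ↦ ?_⟩
  · rw [Polynomial.natDegree_comp, Polynomial.natDegree_X_sub_C, mul_one]
    exact hPd
  · have h1 : (p : ℝ) ^ Nat.log p n * (p : ℝ)⁻¹ ^ h = (p : ℝ)⁻¹ ^ (h - Nat.log p n) := by
      rw [inv_pow, inv_pow, ← Nat.sub_add_cancel hn, pow_add, Nat.add_sub_cancel]
      field_simp
    have h2 := hP ((z - a : ℤ_[p]) : ℚ_[p]) ((p : ℝ)⁻¹ ^ h) (by exact hz) (by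
      rw [h1]
      exact pow_le_one₀ (by positivity) (inv_le_one_of_one_le₀ hp.le))
    rw [h1, ← pow_mul, mul_comm, pow_mul] at h2
    convert h2 using 2
    rw [Polynomial.eval_comp]
    congr 1
    · rw [Polynomial.eval_finsetSum]
      conv_lhs => rw [← add_sub_cancel a z, binomQ_add]
      refine Finset.sum_congr rfl fun ij hij ↦ ?_
      rw [Polynomial.eval_mul, Polynomial.eval_C,
        hQe _ (Finset.HasAntidiagonal.antidiagonal.snd_le hij)]
    · simp

end LocalPolynomials

section Approximation

lemma crNorm_nonneg {p : ℕ} [Fact p.Prime] {L : Type} [NontriviallyNormedField L] (r : ℝ)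
    (f : ℤ_[p] → L) : 0 ≤ crNorm p L r f :=
  Real.iSup_nonneg fun _ ↦ by positivity

variable {p : ℕ} [Fact p.Prime]
variable {L : Type} [NontriviallyNormedField L] [NormedAlgebra ℚ_[p] L]

/-- On every ball of radius `p^{-h}`, `f` is within `ε` of a polynomial of degree at most `d`. -/
def ApproxOn (d h : ℕ) (ε : ℝ) (f : ℤ_[p] → L) : Prop :=
  ∀ a : ℤ_[p], ∃ P : Polynomial L, P.natDegree ≤ d ∧ ∀ z : ℤ_[p], ‖z - a‖ ≤ (p : ℝ)⁻¹ ^ h →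
    ‖f z - P.eval (iotaL p L (z : ℚ_[p]))‖ ≤ ε

lemma ApproxOn.mono {d h : ℕ} {ε ε' : ℝ} {f : ℤ_[p] → L} (hf : ApproxOn d h ε f) (hε : ε ≤ ε') :
    ApproxOn d h ε' f := fun a ↦
  let ⟨P, hPd, hP⟩ := hf a
  ⟨P, hPd, fun z hz ↦ (hP z hz).trans hε⟩

lemma ApproxOn.of_norm_le {d h : ℕ} {ε : ℝ} {f : ℤ_[p] → L} (hf : ∀ z, ‖f z‖ ≤ ε) :
    ApproxOn d h ε f := fun _ ↦
  ⟨0, by simp, fun z _ ↦ by simpa using hf z⟩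

variable (L) in
lemma norm_iotaL (x : ℚ_[p]) : ‖iotaL p L x‖ = ‖x‖ :=
  norm_algebraMap' L x

variable (p) in
lemma prime_inv_pos : 0 < (p : ℝ)⁻¹ := by
  have : 0 < (p : ℝ) := by exact_mod_cast (Fact.out : p.Prime).pos
  positivity

variable (p) in
lemma prime_inv_lt_one : (p : ℝ)⁻¹ < 1 :=
  inv_lt_one_of_one_lt₀ (by exact_mod_cast (Fact.out : p.Prime).one_lt)

lemma norm_le_of_hasSum [IsUltrametricDist L] {t : ℕ → L} {s : L} {ε : ℝ} (hs : HasSum t s)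
    (hε : 0 ≤ ε) (ht : ∀ n, ‖t n‖ ≤ ε) : ‖s‖ ≤ ε :=
  le_of_tendsto hs.norm (Eventually.of_forall fun _ ↦
    IsUltrametricDist.norm_sum_le_of_forall_le_of_nonneg hε fun i _ ↦ ht i)

/-- A Mahler series is approximated by local polynomials according to the size of its
coefficients. -/
lemma approxOn_of_hasSum [IsUltrametricDist L] (d h : ℕ) {f : ℤ_[p] → L} {a : ℕ → L} {ε : ℝ}
    (hf : ∀ z, HasSum (fun n ↦ a n * iotaL p L (binomQ p z n)) (f z)) (hε : 0 ≤ ε)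
    (h1 : ∀ n, h ≤ Nat.log p n → ‖a n‖ ≤ ε)
    (h2 : ∀ n, Nat.log p n ≤ h → ‖a n‖ * ((p : ℝ)⁻¹ ^ (d + 1)) ^ (h - Nat.log p n) ≤ ε) :
    ApproxOn d h ε f := by
  intro b
  have hp1 : 1 < p := (Fact.out : p.Prime).one_lt
  choose! P hPd hP using fun (n : ℕ) (hn : Nat.log p n ≤ h) ↦
    exists_polynomial_near_binomQ (p := p) d b hn
  have hlog : ∀ n ∈ Finset.range (p ^ h), Nat.log p n ≤ h := fun n hn ↦
    (Nat.log_mono_right (Finset.mem_range.mp hn).le).trans (Nat.log_pow hp1 h).le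
  refine ⟨∑ n ∈ Finset.range (p ^ h),
    Polynomial.C (a n) * (P n).map (algebraMap ℚ_[p] L), ?_, fun z hz ↦ ?_⟩
  · refine Polynomial.natDegree_sum_le_of_forall_le _ _ fun n hn ↦ ?_
    exact (Polynomial.natDegree_C_mul_le _ _).trans
      (Polynomial.natDegree_map_le.trans (hPd n (hlog n hn)))
  · have hs := (hf z).sub (hasSum_sum_of_ne_finset_zero (s := Finset.range (p ^ h))
      (f := fun n ↦ if n ∈ Finset.range (p ^ h) then
        a n * iotaL p L ((P n).eval (z : ℚ_[p])) else 0) fun n hn ↦ if_neg hn)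
    have he : (∑ n ∈ Finset.range (p ^ h),
        Polynomial.C (a n) * (P n).map (algebraMap ℚ_[p] L)).eval (iotaL p L (z : ℚ_[p])) =
        ∑ n ∈ Finset.range (p ^ h), if n ∈ Finset.range (p ^ h) then
          a n * iotaL p L ((P n).eval (z : ℚ_[p])) else 0 := by
      rw [Polynomial.eval_finsetSum]
      refine Finset.sum_congr rfl fun n hn ↦ ?_
      rw [if_pos hn, Polynomial.eval_mul, Polynomial.eval_C, iotaL,
        Polynomial.eval_map_algebraMap, Polynomial.aeval_algebraMap_apply]
      simp
    rw [he]
    refine norm_le_of_hasSum hs hε fun n ↦ ?_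
    split_ifs with hn
    · rw [← mul_sub, norm_mul, iotaL, ← map_sub, norm_algebraMap']
      exact (mul_le_mul_of_nonneg_left (hP n (hlog n hn) z hz) (norm_nonneg _)).trans
        (h2 n (hlog n hn))
    · rw [sub_zero, norm_mul, norm_iotaL]
      have hn' : p ^ h ≤ n := by simpa using hn
      refine (mul_le_of_le_one_right (norm_nonneg _) (norm_binomQ_le_one z n)).trans (h1 n ?_)
      exact (Nat.log_pow hp1 h).ge.trans (Nat.log_mono_right hn')

variable (p) in
lemma rpow_neg_pow_mul (r : ℝ) (l : ℕ) :
    ((p : ℝ) ^ (-r)) ^ l * ((p : ℝ) ^ l) ^ r = 1 := by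
  have hp : 0 < (p : ℝ) := by exact_mod_cast (Fact.out : p.Prime).pos
  rw [← Real.rpow_natCast, ← Real.rpow_natCast, ← Real.rpow_mul hp.le, ← Real.rpow_mul hp.le,
    ← Real.rpow_add hp]
  simp [mul_comm]

variable (p) in
lemma rpow_neg_prime_pos (r : ℝ) : 0 < (p : ℝ) ^ (-r) :=
  Real.rpow_pos_of_pos (by exact_mod_cast (Fact.out : p.Prime).pos) _

variable (p) in
lemma rpow_neg_prime_lt_one {r : ℝ} (hr : 0 < r) : (p : ℝ) ^ (-r) < 1 :=
  Real.rpow_lt_one_of_one_lt_of_neg (by exact_mod_cast (Fact.out : p.Prime).one_lt) (by linarith)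

variable (p) in
lemma inv_pow_lt_rpow_neg {r : ℝ} {d : ℕ} (hr : r < d + 1) :
    (p : ℝ)⁻¹ ^ (d + 1) < (p : ℝ) ^ (-r) := by
  have hp : 1 < (p : ℝ) := by exact_mod_cast (Fact.out : p.Prime).one_lt
  rw [inv_pow, ← Real.rpow_natCast, ← Real.rpow_neg (by linarith)]
  exact Real.rpow_lt_rpow_of_exponent_lt hp (by push_cast; linarith)

lemma rpow_le_of_log {r : ℝ} (hr : 0 < r) {n : ℕ} {x C : ℝ} {c : ℝ}
    (hc : ((p : ℝ) ^ Nat.log p n) ≤ c) (hx : 0 ≤ x) (h : c ^ r * x ≤ C) :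
    x ≤ C * ((p : ℝ) ^ (-r)) ^ Nat.log p n := by
  have hp : 0 < (p : ℝ) := by exact_mod_cast (Fact.out : p.Prime).pos
  have h1 := rpow_neg_pow_mul p r (Nat.log p n)
  have h2 : ((p : ℝ) ^ Nat.log p n) ^ r * x ≤ C :=
    (mul_le_mul_of_nonneg_right (Real.rpow_le_rpow (by positivity) hc hr.le) hx).trans h
  have h3 : 0 < ((p : ℝ) ^ (-r)) ^ Nat.log p n := pow_pos (rpow_neg_prime_pos p r) _
  calc x = ((p : ℝ) ^ (-r)) ^ Nat.log p n * (((p : ℝ) ^ Nat.log p n) ^ r * x) := by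
        rw [← mul_assoc, h1, one_mul]
    _ ≤ ((p : ℝ) ^ (-r)) ^ Nat.log p n * C := mul_le_mul_of_nonneg_left h2 h3.le
    _ = _ := mul_comm _ _

lemma IsCr.bddAbove {r : ℝ} (hr : 0 < r) {f : ℤ_[p] → L} (hf : IsCr p L r f) :
    BddAbove (Set.range fun n : ℕ ↦ ((n : ℝ) + 1) ^ r * ‖mahlerCoeff p L f n‖) := by
  obtain ⟨B, hB⟩ := hf.1.bddAbove_range
  refine ⟨max (2 ^ r * B) ‖mahlerCoeff p L f 0‖, ?_⟩
  rintro _ ⟨n, rfl⟩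
  rcases Nat.eq_zero_or_pos n with rfl | hn
  · simp
  · refine le_max_of_le_left ?_
    have hn' : (1 : ℝ) ≤ n := by exact_mod_cast hn
    calc ((n : ℝ) + 1) ^ r * ‖mahlerCoeff p L f n‖
        ≤ (2 * (n : ℝ)) ^ r * ‖mahlerCoeff p L f n‖ := by
          refine mul_le_mul_of_nonneg_right ?_ (norm_nonneg _)
          exact Real.rpow_le_rpow (by positivity) (by linarith) hr.le
      _ = 2 ^ r * ((n : ℝ) ^ r * ‖mahlerCoeff p L f n‖) := by
          rw [Real.mul_rpow (by norm_num) (by positivity), mul_assoc]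
      _ ≤ 2 ^ r * B := mul_le_mul_of_nonneg_left (hB ⟨n, rfl⟩) (by positivity)

lemma IsCr.norm_mahlerCoeff_le {r : ℝ} (hr : 0 < r) {f : ℤ_[p] → L} (hf : IsCr p L r f) (n : ℕ) :
    ‖mahlerCoeff p L f n‖ ≤ crNorm p L r f * ((p : ℝ) ^ (-r)) ^ Nat.log p n := by
  refine rpow_le_of_log hr (c := (n : ℝ) + 1) ?_ (norm_nonneg _) (le_ciSup (hf.bddAbove hr) n)
  rcases Nat.eq_zero_or_pos n with rfl | hn
  · simp
  · have := Nat.pow_log_le_self p hn.ne'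
    have : (p : ℝ) ^ Nat.log p n ≤ n := by exact_mod_cast this
    linarith

lemma IsCr.eventually_norm_mahlerCoeff_le {r : ℝ} (hr : 0 < r) {f : ℤ_[p] → L}
    (hf : IsCr p L r f) {ε : ℝ} (hε : 0 < ε) :
    ∀ᶠ n in atTop, ‖mahlerCoeff p L f n‖ ≤ ε * ((p : ℝ) ^ (-r)) ^ Nat.log p n := by
  filter_upwards [hf.1.eventually_le_const hε, eventually_gt_atTop 0] with n hn hn0
  exact rpow_le_of_log hr (by exact_mod_cast Nat.pow_log_le_self p hn0.ne') (norm_nonneg _) hn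

variable [IsUltrametricDist L]

lemma IsCr.norm_le {r : ℝ} (hr : 0 < r) {f : ℤ_[p] → L} (hf : IsCr p L r f) (z : ℤ_[p]) :
    ‖f z‖ ≤ crNorm p L r f := by
  refine norm_le_of_hasSum (hf.2 z) (crNorm_nonneg r f) fun n ↦ ?_
  rw [norm_mul, norm_iotaL]
  refine (mul_le_of_le_one_right (norm_nonneg _) (norm_binomQ_le_one z n)).trans
    ((hf.norm_mahlerCoeff_le hr n).trans ?_)
  exact mul_le_of_le_one_right (crNorm_nonneg r f)
    (pow_le_one₀ (rpow_neg_prime_pos p r).le (rpow_neg_prime_lt_one p hr).le)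

lemma IsCr.approxOn {r : ℝ} (hr : 0 < r) {d : ℕ} (hrd : r < d + 1) {f : ℤ_[p] → L}
    (hf : IsCr p L r f) (h : ℕ) : ApproxOn d h (crNorm p L r f * ((p : ℝ) ^ (-r)) ^ h) f := by
  have hN := crNorm_nonneg r f
  have hρ := rpow_neg_prime_pos p r
  have hρ1 := (rpow_neg_prime_lt_one p hr).le
  refine approxOn_of_hasSum d h hf.2 (by positivity) (fun n hn ↦ ?_) fun n hn ↦ ?_
  · exact (hf.norm_mahlerCoeff_le hr n).trans
      (mul_le_mul_of_nonneg_left (pow_le_pow_of_le_one hρ.le hρ1 hn) hN)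
  · have h1 : ((p : ℝ)⁻¹ ^ (d + 1)) ^ (h - Nat.log p n) ≤ ((p : ℝ) ^ (-r)) ^ (h - Nat.log p n) :=
      pow_le_pow_left₀ (by positivity) (inv_pow_lt_rpow_neg p hrd).le _
    refine (mul_le_mul (hf.norm_mahlerCoeff_le hr n) h1 (by positivity) (by positivity)).trans ?_
    rw [mul_assoc, ← pow_add, Nat.add_sub_cancel' hn]

lemma IsCr.eventually_approxOn {r : ℝ} (hr : 0 < r) {d : ℕ} (hrd : r < d + 1) {f : ℤ_[p] → L}
    (hf : IsCr p L r f) {ε : ℝ} (hε : 0 < ε) :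
    ∀ᶠ h in atTop, ApproxOn d h (ε * ((p : ℝ) ^ (-r)) ^ h) f := by
  have hN := crNorm_nonneg r f
  have hρ := rpow_neg_prime_pos p r
  have hρ1 := (rpow_neg_prime_lt_one p hr).le
  set ρ := (p : ℝ) ^ (-r) with hρdef
  set σ := (p : ℝ)⁻¹ ^ (d + 1) with hσdef
  have hσ0 : 0 ≤ σ := by positivity
  have hσ : σ < ρ := inv_pow_lt_rpow_neg p hrd
  obtain ⟨n₀, hn₀⟩ := eventually_atTop.mp (hf.eventually_norm_mahlerCoeff_le hr hε)
  have ht : Tendsto (fun t : ℕ ↦ crNorm p L r f * (σ / ρ) ^ t) atTop (𝓝 0) := by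
    simpa using (tendsto_pow_atTop_nhds_zero_of_lt_one (by positivity)
      ((div_lt_one hρ).mpr hσ)).const_mul (crNorm p L r f)
  obtain ⟨t₀, ht₀⟩ := eventually_atTop.mp (ht.eventually_le_const hε)
  filter_upwards [eventually_gt_atTop (t₀ + Nat.log p n₀)] with h hh
  refine approxOn_of_hasSum d h hf.2 (by positivity) (fun n hn ↦ ?_) fun n hn ↦ ?_
  · have hnn : n₀ ≤ n := by
      by_contra! hlt
      have := Nat.log_mono_right (b := p) hlt.le
      lia
    exact (hn₀ n hnn).trans (mul_le_mul_of_nonneg_left (pow_le_pow_of_le_one hρ.le hρ1 hn) hε.le)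
  · by_cases hnn : n₀ ≤ n
    · refine (mul_le_mul (hn₀ n hnn) (pow_le_pow_left₀ hσ0 hσ.le _) (by positivity)
        (by positivity)).trans ?_
      rw [mul_assoc, ← pow_add, Nat.add_sub_cancel' hn]
    · have hl : Nat.log p n ≤ Nat.log p n₀ := Nat.log_mono_right (by lia)
      refine (mul_le_mul_of_nonneg_right (hf.norm_mahlerCoeff_le hr n) (by positivity)).trans ?_
      have h3 := ht₀ (h - Nat.log p n) (by lia)
      calc crNorm p L r f * ρ ^ Nat.log p n * σ ^ (h - Nat.log p n)
          = crNorm p L r f * (σ / ρ) ^ (h - Nat.log p n) *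
              (ρ ^ Nat.log p n * ρ ^ (h - Nat.log p n)) := by
            rw [div_pow]
            field_simp
        _ ≤ ε * ρ ^ h := by
            rw [← pow_add, Nat.add_sub_cancel' hn]
            exact mul_le_mul_of_nonneg_right h3 (by positivity)

end Approximation

section MahlerCoefficients

variable {p : ℕ} [Fact p.Prime]
variable {L : Type} [NontriviallyNormedField L]

lemma mahlerCoeff_eq_fwdDiff (f : ℤ_[p] → L) (n : ℕ) :
    mahlerCoeff p L f n = (fwdDiff 1)^[n] f 0 := by
  rw [fwdDiff_iter_eq_sum_shift, mahlerCoeff, ← Finset.sum_range_reflect]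
  refine Finset.sum_congr rfl fun i hi ↦ ?_
  have hi' : i ≤ n := Nat.lt_succ_iff.mp (Finset.mem_range.mp hi)
  have h1 : n + 1 - 1 - i = n - i := by lia
  rw [h1, Nat.sub_sub_self hi', Nat.choose_symm hi', zsmul_eq_mul]
  simp

lemma mahlerCoeff_add (f g : ℤ_[p] → L) (n : ℕ) :
    mahlerCoeff p L (f + g) n = mahlerCoeff p L f n + mahlerCoeff p L g n := by
  simp [mahlerCoeff_eq_fwdDiff]

lemma mahlerCoeff_smul (c : L) (f : ℤ_[p] → L) (n : ℕ) :
    mahlerCoeff p L (c • f) n = c * mahlerCoeff p L f n := by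
  simp [mahlerCoeff_eq_fwdDiff]

lemma norm_aeval_fwdDiff_le [IsUltrametricDist L] (Q : Polynomial ℤ) {g : ℤ_[p] → L} {M : ℝ}
    (hg : ∀ z, ‖g z‖ ≤ M)
    (z : ℤ_[p]) : ‖Polynomial.aeval (fwdDiff_aux.fwdDiffₗ ℤ_[p] L 1) Q g z‖ ≤ M := by
  induction Q using Polynomial.induction_on' with
  | add P Q hP hQ =>
    rw [map_add]
    exact (IsUltrametricDist.norm_add_le_max _ _).trans (max_le hP hQ)
  | monomial n c =>
    rw [Polynomial.aeval_monomial, Module.End.mul_apply, Module.algebraMap_end_apply,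
      Module.End.pow_apply, fwdDiff_aux.coe_fwdDiffₗ, Pi.smul_apply]
    refine (IsUltrametricDist.norm_zsmul_le _ _).trans ?_
    rw [fwdDiff_iter_eq_sum_shift]
    refine IsUltrametricDist.norm_sum_le_of_forall_le_of_nonneg ((norm_nonneg _).trans (hg 0))
      fun i _ ↦ (IsUltrametricDist.norm_zsmul_le _ _).trans (hg _)

lemma norm_mahlerCoeff_le_of_forall [IsUltrametricDist L] {g : ℤ_[p] → L} {M : ℝ}
    (hg : ∀ z, ‖g z‖ ≤ M) (n : ℕ) :
    ‖mahlerCoeff p L g n‖ ≤ M := by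
  have h := norm_aeval_fwdDiff_le (Polynomial.X ^ n) hg 0
  rwa [map_pow, Polynomial.aeval_X, Module.End.pow_apply, fwdDiff_aux.coe_fwdDiffₗ,
    ← mahlerCoeff_eq_fwdDiff] at h

/-- In `ℤ[X]`, a high power of `X` is a combination of `((1 + X)^{p^h} - 1)^{d+1}` and `p^e`. -/
lemma exists_X_pow_eq (h d e n : ℕ) (hn : (d + e) * p ^ h ≤ n) :
    ∃ U V : Polynomial ℤ, (Polynomial.X : Polynomial ℤ) ^ n =
      U * ((Polynomial.X + 1) ^ p ^ h - 1) ^ (d + 1) + V * (p : Polynomial ℤ) ^ e := by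
  obtain ⟨s, hs⟩ := exists_add_pow_prime_pow_eq (Fact.out : p.Prime)
    (Polynomial.X : Polynomial ℤ) 1 h
  set D : Polynomial ℤ := (Polynomial.X + 1) ^ p ^ h - 1 with hD
  have hX : (Polynomial.X : Polynomial ℤ) ^ p ^ h =
      D + (p : Polynomial ℤ) * (-(Polynomial.X * s)) := by
    rw [hD, hs]
    ring
  have hmem : ((Polynomial.X : Polynomial ℤ) ^ p ^ h) ^ (d + e) ∈
      Ideal.span {D ^ (d + 1), (p : Polynomial ℤ) ^ e} := by
    rw [hX]
    refine Ideal.add_pow_mem_of_pow_mem_of_le _ (m := d + 1) (n := e) ?_ ?_ (by lia)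
    · exact Ideal.subset_span (by simp)
    · rw [mul_pow]
      exact Ideal.mul_mem_right _ _ (Ideal.subset_span (by simp))
  obtain ⟨U, V, hUV⟩ := Ideal.mem_span_pair.mp hmem
  refine ⟨Polynomial.X ^ (n - (d + e) * p ^ h) * U, Polynomial.X ^ (n - (d + e) * p ^ h) * V, ?_⟩
  rw [mul_assoc, mul_assoc, ← mul_add, hUV, ← pow_mul, ← pow_add]
  congr 1
  rw [mul_comm (p ^ h)]
  lia

variable [NormedAlgebra ℚ_[p] L]

lemma norm_natCast_prime : ‖(p : L)‖ = (p : ℝ)⁻¹ := by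
  rw [← map_natCast (algebraMap ℚ_[p] L) p, norm_algebraMap', Padic.norm_p]

lemma aeval_fwdDiff_eq_zero {d h : ℕ} {g : ℤ_[p] → L} (hg : ApproxOn d h 0 g) :
    Polynomial.aeval (fwdDiff_aux.fwdDiffₗ ℤ_[p] L 1)
      (((Polynomial.X + 1) ^ p ^ h - 1 : Polynomial ℤ) ^ (d + 1)) g = 0 := by
  have h1 : Polynomial.aeval (fwdDiff_aux.fwdDiffₗ ℤ_[p] L 1)
      ((Polynomial.X + 1) ^ p ^ h - 1 : Polynomial ℤ) =
      fwdDiff_aux.fwdDiffₗ ℤ_[p] L ((p : ℤ_[p]) ^ h) := by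
    rw [map_sub, map_pow, map_add, Polynomial.aeval_X, map_one]
    ext f z
    have := fwdDiff_aux.shiftₗ_pow_apply (1 : ℤ_[p]) f (p ^ h) z
    rw [fwdDiff_aux.shiftₗ] at this
    rw [LinearMap.sub_apply, Pi.sub_apply, this, fwdDiff_aux.coe_fwdDiffₗ, fwdDiff]
    simp
  rw [map_pow, h1]
  ext z
  rw [Module.End.pow_apply, fwdDiff_aux.coe_fwdDiffₗ, fwdDiff_iter_eq_sum_shift]
  obtain ⟨P, hPd, hP⟩ := hg z
  set Q : Polynomial L := P.comp (Polynomial.C (algebraMap ℚ_[p] L ((p : ℚ_[p]) ^ h)) *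
    Polynomial.X + Polynomial.C (iotaL p L (z : ℚ_[p]))) with hQ
  have hQd : Q.natDegree < d + 1 := by
    refine Nat.lt_succ_of_le (Polynomial.natDegree_comp_le.trans ?_)
    exact (Nat.mul_le_mul hPd Polynomial.natDegree_linear_le).trans (mul_one d).le
  have h2 := congrFun (Polynomial.fwdDiff_iter_eq_zero_of_degree_lt hQd) 0
  rw [fwdDiff_iter_eq_sum_shift] at h2
  refine Eq.trans ?_ h2
  refine Finset.sum_congr rfl fun i _ ↦ ?_
  congr 1
  have h3 := hP (z + i • (p : ℤ_[p]) ^ h) (by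
    rw [add_sub_cancel_left, nsmul_eq_mul, norm_mul, PadicInt.norm_p_pow, zpow_neg, zpow_natCast,
      inv_pow]
    exact mul_le_of_le_one_left (by positivity) (PadicInt.norm_le_one _))
  rw [norm_le_zero_iff, sub_eq_zero] at h3
  rw [h3, hQ, Polynomial.eval_comp]
  congr 1
  simp [iotaL, mul_comm, add_comm]

/-- Decay of the Mahler coefficients of a locally polynomial function. -/
lemma norm_mahlerCoeff_le_of_locPoly [IsUltrametricDist L] {d h : ℕ} {g : ℤ_[p] → L}
    (hg : ApproxOn d h 0 g) {M : ℝ}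
    (hM : ∀ z, ‖g z‖ ≤ M) {m n : ℕ} (hn : m * p ^ h ≤ n) :
    ‖mahlerCoeff p L g n‖ ≤ M * ((p : ℝ) ^ d * (p : ℝ)⁻¹ ^ m) := by
  have hp : 1 < (p : ℝ) := by exact_mod_cast (Fact.out : p.Prime).one_lt
  have hM0 : 0 ≤ M := (norm_nonneg _).trans (hM 0)
  rcases le_total m d with hmd | hmd
  · refine (norm_mahlerCoeff_le_of_forall hM n).trans (le_mul_of_one_le_right hM0 ?_)
    rw [inv_pow, ← div_eq_mul_inv, one_le_div (by positivity)]
    exact pow_le_pow_right₀ hp.le hmd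
  · obtain ⟨e, rfl⟩ := Nat.exists_eq_add_of_le hmd
    obtain ⟨U, V, hUV⟩ := exists_X_pow_eq (p := p) h d e n hn
    have h1 : mahlerCoeff p L g n =
        Polynomial.aeval (fwdDiff_aux.fwdDiffₗ ℤ_[p] L 1)
          (Polynomial.X ^ n : Polynomial ℤ) g 0 := by
      rw [map_pow, Polynomial.aeval_X, Module.End.pow_apply, fwdDiff_aux.coe_fwdDiffₗ,
        mahlerCoeff_eq_fwdDiff]
    rw [h1, hUV, map_add, map_mul, map_mul, LinearMap.add_apply, Module.End.mul_apply,
      Module.End.mul_apply, aeval_fwdDiff_eq_zero hg, map_zero, zero_add]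
    have h2 : (p : ℝ) ^ d * (p : ℝ)⁻¹ ^ (d + e) = (p : ℝ)⁻¹ ^ e := by
      rw [pow_add, ← mul_assoc, ← mul_pow, mul_inv_cancel₀ (by positivity), one_pow, one_mul]
    rw [h2, mul_comm]
    refine norm_aeval_fwdDiff_le V (fun z ↦ ?_) 0
    have h3 : Polynomial.aeval (fwdDiff_aux.fwdDiffₗ ℤ_[p] L 1) ((p : Polynomial ℤ) ^ e) g z =
        (p : L) ^ e * g z := by
      rw [← Nat.cast_pow, map_natCast, Module.End.natCast_apply, Pi.smul_apply, nsmul_eq_mul,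
        Nat.cast_pow]
    rw [h3, norm_mul, norm_pow, norm_natCast_prime]
    exact mul_le_mul_of_nonneg_left (hM z) (by positivity)

end MahlerCoefficients

section Converse

variable {p : ℕ} [Fact p.Prime]
variable {L : Type} [NontriviallyNormedField L] [NormedAlgebra ℚ_[p] L]

lemma norm_sub_le_max_norm {E : Type*} [SeminormedAddCommGroup E] [IsUltrametricDist E] (x y : E) :
    ‖x - y‖ ≤ max ‖x‖ ‖y‖ := by
  simpa [sub_eq_add_neg] using IsUltrametricDist.norm_add_le_max x (-y)

lemma ApproxOn.anti {d h h' : ℕ} {ε : ℝ} {f : ℤ_[p] → L} (hf : ApproxOn d h ε f) (hh : h ≤ h') :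
    ApproxOn d h' ε f := fun a ↦
  let ⟨P, hPd, hP⟩ := hf a
  ⟨P, hPd, fun z hz ↦ hP z (hz.trans
    (pow_le_pow_of_le_one (prime_inv_pos p).le (prime_inv_lt_one p).le hh))⟩

lemma ApproxOn.sub [IsUltrametricDist L] {d h : ℕ} {ε : ℝ} {f g : ℤ_[p] → L}
    (hf : ApproxOn d h ε f) (hg : ApproxOn d h ε g) : ApproxOn d h ε (f - g) := by
  intro a
  obtain ⟨P, hPd, hP⟩ := hf a
  obtain ⟨Q, hQd, hQ⟩ := hg a
  refine ⟨P - Q, (Polynomial.natDegree_sub_le P Q).trans (max_le hPd hQd), fun z hz ↦ ?_⟩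
  rw [Pi.sub_apply, Polynomial.eval_sub, sub_sub_sub_comm]
  exact (norm_sub_le_max_norm _ _).trans (max_le (hP z hz) (hQ z hz))

/-- The local polynomials in the definition of `ApproxOn` can be glued. -/
lemma ApproxOn.exists_locPoly {d h : ℕ} {ε : ℝ} {f : ℤ_[p] → L} (hf : ApproxOn d h ε f) :
    ∃ g : ℤ_[p] → L, ApproxOn d h 0 g ∧ ∀ z, ‖f z - g z‖ ≤ ε := by
  have hp : (p : ℝ)⁻¹ ^ h = (p : ℝ) ^ (-(h : ℤ)) := by rw [zpow_neg, zpow_natCast, inv_pow]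
  choose P hPd hP using hf
  set rep : ℤ_[p] → ℤ_[p] := fun z ↦ ((PadicInt.toZModPow h z).val : ℤ_[p]) with hrep
  have hclose (z : ℤ_[p]) : ‖z - rep z‖ ≤ (p : ℝ)⁻¹ ^ h := by
    rw [hp, PadicInt.norm_le_pow_iff_mem_span_pow, ← PadicInt.ker_toZModPow, RingHom.mem_ker,
      map_sub, hrep]
    have : NeZero (p ^ h) := ⟨pow_ne_zero _ (Fact.out : p.Prime).ne_zero⟩
    simp
  refine ⟨fun z ↦ (P (rep z)).eval (iotaL p L (z : ℚ_[p])),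
    fun a ↦ ⟨P (rep a), hPd _, fun z hz ↦ ?_⟩, fun z ↦ hP _ z (hclose z)⟩
  have : rep z = rep a := by
    rw [hp, PadicInt.norm_le_pow_iff_mem_span_pow, ← PadicInt.ker_toZModPow, RingHom.mem_ker,
      map_sub, sub_eq_zero] at hz
    simp only [hrep, hz]
  simp [this]

variable (p) in
lemma exists_inv_pow_prime_pow_le {r : ℝ} {d : ℕ} (hrd : r < d + 1) :
    ∃ B : ℝ, 1 ≤ B ∧ ∀ t : ℕ, (p : ℝ)⁻¹ ^ p ^ t ≤ B * (((p : ℝ) ^ (-r)) ^ t * (p : ℝ)⁻¹ ^ t) := by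
  have hp : 0 < (p : ℝ) := by exact_mod_cast (Fact.out : p.Prime).pos
  have hlim := tendsto_pow_const_mul_const_pow_of_abs_lt_one (d + 2) (r := (p : ℝ)⁻¹)
    (by rw [abs_of_pos (prime_inv_pos p)]; exact prime_inv_lt_one p)
  obtain ⟨B, hB⟩ := hlim.bddAbove_range
  refine ⟨max B 1, le_max_right _ _, fun t ↦ ?_⟩
  have h1 : (((p ^ t : ℕ) : ℝ)) ^ (d + 2) * (p : ℝ)⁻¹ ^ p ^ t ≤ max B 1 :=
    (hB ⟨p ^ t, rfl⟩).trans (le_max_left _ _)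
  have h2 : ((p : ℝ)⁻¹ ^ (d + 1)) ^ t ≤ ((p : ℝ) ^ (-r)) ^ t :=
    pow_le_pow_left₀ (by positivity) (inv_pow_lt_rpow_neg p hrd).le _
  have h3 : ((p : ℝ)⁻¹ ^ (d + 1)) ^ t * (p : ℝ)⁻¹ ^ t * (((p ^ t : ℕ) : ℝ)) ^ (d + 2) = 1 := by
    push_cast
    rw [← pow_mul, ← pow_add, ← pow_mul, inv_pow, show (d + 1) * t + t = t * (d + 2) by ring]
    exact inv_mul_cancel₀ (by positivity)
  calc (p : ℝ)⁻¹ ^ p ^ t = ((p : ℝ)⁻¹ ^ (d + 1)) ^ t * (p : ℝ)⁻¹ ^ t *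
        ((((p ^ t : ℕ) : ℝ)) ^ (d + 2) * (p : ℝ)⁻¹ ^ p ^ t) := by rw [← mul_assoc, h3, one_mul]
    _ ≤ ((p : ℝ) ^ (-r)) ^ t * (p : ℝ)⁻¹ ^ t * max B 1 := by gcongr
    _ = _ := mul_comm _ _

lemma continuous_of_approxOn {d : ℕ} {f : ℤ_[p] → L} (hf : ∀ ε > 0, ∃ h, ApproxOn d h ε f) :
    Continuous f := by
  rw [Metric.continuous_iff]
  intro a ε hε
  obtain ⟨h, hh⟩ := hf (ε / 3) (by positivity)
  obtain ⟨P, -, hP⟩ := hh a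
  have hc : Continuous fun z : ℤ_[p] ↦ P.eval (iotaL p L (z : ℚ_[p])) :=
    P.continuous.comp ((algebraMapCLM ℚ_[p] L).continuous.comp continuous_subtype_val)
  obtain ⟨δ, hδ, hδP⟩ := Metric.continuous_iff.mp hc a (ε / 3) (by positivity)
  have hpos : 0 < (p : ℝ)⁻¹ ^ h := pow_pos (prime_inv_pos p) h
  refine ⟨min δ ((p : ℝ)⁻¹ ^ h), lt_min hδ hpos, fun z hz ↦ ?_⟩
  have h1 := hP z (by rw [← dist_eq_norm]; exact (hz.trans_le (min_le_right _ _)).le)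
  have h2 := hP a (by rw [sub_self, norm_zero]; exact hpos.le)
  have h3 := hδP z (hz.trans_le (min_le_left _ _))
  rw [← dist_eq_norm] at h1 h2
  have h4 := dist_triangle4 (f z) (P.eval (iotaL p L (z : ℚ_[p])))
    (P.eval (iotaL p L (a : ℚ_[p]))) (f a)
  rw [dist_comm (P.eval (iotaL p L (a : ℚ_[p]))) (f a)] at h4
  linarith

lemma IsCr.add {r : ℝ} {f g : ℤ_[p] → L} (hf : IsCr p L r f) (hg : IsCr p L r g) :
    IsCr p L r (f + g) := by
  refine ⟨?_, fun z ↦ ?_⟩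
  · refine squeeze_zero (fun n ↦ by positivity) (fun n ↦ ?_) (by simpa using hf.1.add hg.1)
    rw [mahlerCoeff_add, ← mul_add]
    exact mul_le_mul_of_nonneg_left (norm_add_le _ _) (by positivity)
  · simpa only [mahlerCoeff_add, add_mul, Pi.add_apply] using (hf.2 z).add (hg.2 z)

lemma IsCr.const_smul {r : ℝ} {f : ℤ_[p] → L} (c : L) (hf : IsCr p L r f) :
    IsCr p L r (c • f) := by
  refine ⟨?_, fun z ↦ ?_⟩
  · simpa only [mahlerCoeff_smul, norm_mul, mul_zero, mul_left_comm] using hf.1.const_mul ‖c‖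
  · simpa only [mahlerCoeff_smul, mul_assoc, Pi.smul_apply, smul_eq_mul] using (hf.2 z).mul_left c

variable [IsUltrametricDist L]

variable (p L) in
lemma exists_norm_mahlerCoeff_le_of_locPoly {r : ℝ} {d : ℕ} (hrd : r < d + 1) :
    ∃ K : ℝ, 1 ≤ K ∧ ∀ (j n : ℕ) (g : ℤ_[p] → L) (M : ℝ), ApproxOn d j 0 g → (∀ z, ‖g z‖ ≤ M) →
      j ≤ Nat.log p n → ‖mahlerCoeff p L g n‖ ≤
        K * (M * (((p : ℝ) ^ (-r)) ^ (Nat.log p n - j) * (p : ℝ)⁻¹ ^ (Nat.log p n - j))) := by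
  obtain ⟨B, hB1, hB⟩ := exists_inv_pow_prime_pow_le p hrd
  have hp : 1 ≤ (p : ℝ) := by exact_mod_cast (Fact.out : p.Prime).one_le
  have hK : 1 ≤ (p : ℝ) ^ d * B := one_le_mul_of_one_le_of_one_le (one_le_pow₀ hp) hB1
  refine ⟨(p : ℝ) ^ d * B, hK, fun j n g M hg hM hj ↦ ?_⟩
  have hM0 : 0 ≤ M := (norm_nonneg _).trans (hM 0)
  rcases Nat.eq_zero_or_pos n with rfl | hn
  · refine (norm_mahlerCoeff_le_of_forall hM 0).trans ?_
    simpa using le_mul_of_one_le_left hM0 hK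
  · have h1 : p ^ (Nat.log p n - j) * p ^ j ≤ n := by
      rw [← pow_add, Nat.sub_add_cancel hj]
      exact Nat.pow_log_le_self p hn.ne'
    refine (norm_mahlerCoeff_le_of_locPoly hg hM h1).trans ?_
    calc M * ((p : ℝ) ^ d * (p : ℝ)⁻¹ ^ p ^ (Nat.log p n - j))
        ≤ M * ((p : ℝ) ^ d * (B * (((p : ℝ) ^ (-r)) ^ (Nat.log p n - j) *
          (p : ℝ)⁻¹ ^ (Nat.log p n - j)))) := by
          gcongr
          exact hB _
      _ = _ := by ring

variable (p L) in
/-- Decay of the Mahler coefficients of a function that is well approximated by local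
polynomials. -/
lemma exists_norm_mahlerCoeff_le_of_approxOn {r : ℝ} (hr : 0 < r) {d : ℕ} (hrd : r < d + 1) :
    ∃ K : ℝ, 1 ≤ K ∧ ∀ (H n : ℕ) (f : ℤ_[p] → L) (ε M : ℝ), (∀ z, ‖f z‖ ≤ M) → 0 ≤ ε → ε ≤ M →
      (∀ j, H ≤ j → ApproxOn d j (ε * ((p : ℝ) ^ (-r)) ^ j) f) → H ≤ Nat.log p n →
      ‖mahlerCoeff p L f n‖ ≤ max (K * (ε * ((p : ℝ) ^ (-r)) ^ Nat.log p n))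
        (K * (M * (((p : ℝ) ^ (-r)) ^ (Nat.log p n - H) * (p : ℝ)⁻¹ ^ (Nat.log p n - H)))) := by
  obtain ⟨K, hK1, hK⟩ := exists_norm_mahlerCoeff_le_of_locPoly p L hrd
  have hρ := rpow_neg_prime_pos p r
  have hρ1 := (rpow_neg_prime_lt_one p hr).le
  set ρ := (p : ℝ) ^ (-r) with hρdef
  have hKK : K ≤ K * ρ⁻¹ := le_mul_of_one_le_right (by linarith) ((one_le_inv₀ hρ).mpr hρ1)
  refine ⟨K * ρ⁻¹, hK1.trans hKK, fun H n f ε M hM hε hεM happ hH ↦ ?_⟩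
  have hM0 : 0 ≤ M := (norm_nonneg _).trans (hM 0)
  choose! g hg hfg using fun j (hj : H ≤ j) ↦ (happ j hj).exists_locPoly
  set X := max (K * ρ⁻¹ * (ε * ρ ^ Nat.log p n))
    (K * ρ⁻¹ * (M * (ρ ^ (Nat.log p n - H) * (p : ℝ)⁻¹ ^ (Nat.log p n - H)))) with hX
  have hpinv := (prime_inv_pos p).le
  have key : ∀ j, H ≤ j → j ≤ Nat.log p n → ‖mahlerCoeff p L (g j) n‖ ≤ X := by
    intro j hj
    induction j, hj using Nat.le_induction with
    | base =>
      intro _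
      refine le_max_of_le_right ((hK H n (g H) M (hg H le_rfl) (fun z ↦ ?_) hH).trans ?_)
      · have h1 : g H z = f z - (f z - g H z) := by ring
        rw [h1]
        refine (norm_sub_le_max_norm _ _).trans (max_le (hM z) ?_)
        exact (hfg H le_rfl z).trans ((mul_le_of_le_one_right hε (pow_le_one₀ hρ.le hρ1)).trans hεM)
      · exact mul_le_mul_of_nonneg_right hKK (by positivity)
    | succ j hj ih =>
      intro hjn
      have h1 : g (j + 1) = g j + (g (j + 1) - g j) := by ring
      rw [h1, mahlerCoeff_add]
      refine (IsUltrametricDist.norm_add_le_max _ _).trans (max_le (ih (by lia)) ?_)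
      refine le_max_of_le_left ((hK (j + 1) n _ (ε * ρ ^ j)
        ((hg (j + 1) (by lia)).sub ((hg j hj).anti (Nat.le_succ j))) (fun z ↦ ?_) hjn).trans ?_)
      · have h2 : (g (j + 1) - g j) z = (f z - g j z) - (f z - g (j + 1) z) := by
          rw [Pi.sub_apply]
          ring
        rw [h2]
        refine (norm_sub_le_max_norm _ _).trans (max_le (hfg j hj z) ?_)
        exact (hfg (j + 1) (by lia) z).trans
          (mul_le_mul_of_nonneg_left (pow_le_pow_of_le_one hρ.le hρ1 (Nat.le_succ j)) hε)
      · obtain ⟨t, ht⟩ := Nat.exists_eq_add_of_le hjn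
        rw [ht, Nat.add_sub_cancel_left]
        have h3 : K * ρ⁻¹ * (ε * ρ ^ (j + 1 + t)) = K * (ε * ρ ^ j * (ρ ^ t * 1)) := by
          rw [pow_add, pow_succ]
          field_simp
        rw [h3]
        have : (p : ℝ)⁻¹ ^ t ≤ 1 := pow_le_one₀ hpinv (prime_inv_lt_one p).le
        gcongr
  have h1 : f = g (Nat.log p n) + (f - g (Nat.log p n)) := by ring
  rw [h1, mahlerCoeff_add]
  refine (IsUltrametricDist.norm_add_le_max _ _).trans (max_le (key _ hH le_rfl) ?_)
  refine le_max_of_le_left ((norm_mahlerCoeff_le_of_forall (hfg _ hH) n).trans ?_)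
  exact le_mul_of_one_le_left (by positivity) (hK1.trans hKK)

variable (p L) in
lemma exists_crNorm_le {r : ℝ} (hr : 0 < r) {d : ℕ} (hrd : r < d + 1) :
    ∃ K : ℝ, 0 < K ∧ ∀ (f : ℤ_[p] → L) (C : ℝ), (∀ z, ‖f z‖ ≤ C) →
      (∀ h, ApproxOn d h (C * ((p : ℝ) ^ (-r)) ^ h) f) → crNorm p L r f ≤ K * C := by
  obtain ⟨K, hK1, hK⟩ := exists_norm_mahlerCoeff_le_of_approxOn p L hr hrd
  have hp : 1 < p := (Fact.out : p.Prime).one_lt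
  have hp0 : 0 < (p : ℝ) := by exact_mod_cast (Fact.out : p.Prime).pos
  have hpr : 0 < (p : ℝ) ^ r := Real.rpow_pos_of_pos hp0 r
  refine ⟨(p : ℝ) ^ r * K, by positivity, fun f C hC happ ↦ ciSup_le fun n ↦ ?_⟩
  have hC0 : 0 ≤ C := (norm_nonneg _).trans (hC 0)
  have hρ := rpow_neg_prime_pos p r
  have h1 : ‖mahlerCoeff p L f n‖ ≤ K * (C * ((p : ℝ) ^ (-r)) ^ Nat.log p n) := by
    refine (hK 0 n f C C hC hC0 le_rfl (fun j _ ↦ happ j) (Nat.zero_le _)).trans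
      (max_le le_rfl ?_)
    rw [Nat.sub_zero]
    have : (p : ℝ)⁻¹ ^ Nat.log p n ≤ 1 :=
      pow_le_one₀ (prime_inv_pos p).le (prime_inv_lt_one p).le
    have h2 : ((p : ℝ) ^ (-r)) ^ Nat.log p n * (p : ℝ)⁻¹ ^ Nat.log p n ≤
        ((p : ℝ) ^ (-r)) ^ Nat.log p n := mul_le_of_le_one_right (by positivity) this
    gcongr
  have h2 : ((n : ℝ) + 1) ^ r ≤ (p : ℝ) ^ r * ((p : ℝ) ^ Nat.log p n) ^ r := by
    rw [← Real.mul_rpow hp0.le (by positivity)]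
    refine Real.rpow_le_rpow (by positivity) ?_ hr.le
    have := Nat.lt_pow_succ_log_self hp n
    rw [pow_succ'] at this
    exact_mod_cast this
  calc ((n : ℝ) + 1) ^ r * ‖mahlerCoeff p L f n‖
      ≤ (p : ℝ) ^ r * ((p : ℝ) ^ Nat.log p n) ^ r *
        (K * (C * ((p : ℝ) ^ (-r)) ^ Nat.log p n)) := by gcongr
    _ = (p : ℝ) ^ r * K * C * (((p : ℝ) ^ (-r)) ^ Nat.log p n * ((p : ℝ) ^ Nat.log p n) ^ r) := by
      ring
    _ = _ := by rw [rpow_neg_pow_mul, mul_one]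

lemma hasSum_mahlerCoeff [CompleteSpace L] {f : ℤ_[p] → L} (hf : Continuous f) (z : ℤ_[p]) :
    HasSum (fun n ↦ mahlerCoeff p L f n * iotaL p L (binomQ p z n)) (f z) := by
  let φ : ℤ_[p] →+* L := (algebraMap ℚ_[p] L).comp (PadicInt.Coe.ringHom (p := p))
  let _ : Module ℤ_[p] L := Module.compHom L φ
  have : IsBoundedSMul ℤ_[p] L := IsBoundedSMul.of_norm_smul_le fun x y ↦ by
    change ‖φ x * y‖ ≤ _
    rw [norm_mul]
    refine le_of_eq ?_
    congr 1
    exact norm_algebraMap' L (x : ℚ_[p])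
  have h := PadicInt.hasSum_mahler (⟨f, hf⟩ : C(ℤ_[p], L))
  have h2 := h.map (ContinuousMap.evalCLM ℤ_[p] z : C(ℤ_[p], L) →L[ℤ_[p]] L)
    (ContinuousMap.evalCLM ℤ_[p] z).continuous
  refine Eq.mp (congrArg (fun t ↦ HasSum t (f z)) (funext fun n ↦ ?_)) h2
  symm
  rw [mahlerCoeff_eq_fwdDiff, ← coe_choose_eq_binomQ, mul_comm]
  rfl

lemma isCr_of_approxOn [CompleteSpace L] {r : ℝ} (hr : 0 < r) {d : ℕ} (hrd : r < d + 1)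
    {f : ℤ_[p] → L} {M : ℝ} (hM : ∀ z, ‖f z‖ ≤ M)
    (hf : ∀ ε > 0, ∀ᶠ h in atTop, ApproxOn d h (ε * ((p : ℝ) ^ (-r)) ^ h) f) :
    IsCr p L r f := by
  have hρ := rpow_neg_prime_pos p r
  have hρ1 := (rpow_neg_prime_lt_one p hr).le
  refine ⟨?_, fun z ↦ hasSum_mahlerCoeff (continuous_of_approxOn (d := d) fun ε hε ↦ ?_) z⟩
  · obtain ⟨K, hK1, hK⟩ := exists_norm_mahlerCoeff_le_of_approxOn p L hr hrd
    refine Metric.tendsto_atTop'.mpr fun ε hε ↦ ?_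
    have hp : 1 < p := (Fact.out : p.Prime).one_lt
    have hp0 : 0 < (p : ℝ) := by exact_mod_cast (Fact.out : p.Prime).pos
    have hpr : 0 < (p : ℝ) ^ r := Real.rpow_pos_of_pos hp0 r
    have hM0 : 0 ≤ M := (norm_nonneg _).trans (hM 0)
    set e := ε / (2 * K * (p : ℝ) ^ r) with he
    have he0 : 0 < e := by positivity
    obtain ⟨H, hH⟩ := eventually_atTop.mp (hf e he0)
    have ht : Tendsto (fun t : ℕ ↦ max M e * (((p : ℝ) ^ (-r)) ^ H)⁻¹ * (p : ℝ)⁻¹ ^ t) atTop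
        (𝓝 0) := by
      simpa using (tendsto_pow_atTop_nhds_zero_of_lt_one (prime_inv_pos p).le
        (prime_inv_lt_one p)).const_mul (max M e * (((p : ℝ) ^ (-r)) ^ H)⁻¹)
    obtain ⟨T, hT⟩ := eventually_atTop.mp (ht.eventually_le_const he0)
    refine ⟨p ^ (H + T), fun n hn ↦ ?_⟩
    have hlog : H + T ≤ Nat.log p n :=
      (Nat.log_pow hp _).ge.trans (Nat.log_mono_right hn.le)
    have h1 : ‖mahlerCoeff p L f n‖ ≤ K * (e * ((p : ℝ) ^ (-r)) ^ Nat.log p n) := by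
      refine (hK H n f e (max M e) (fun z ↦ (hM z).trans (le_max_left _ _)) he0.le
        (le_max_right _ _) hH (by lia)).trans (max_le le_rfl ?_)
      have h3 := hT (Nat.log p n - H) (by lia)
      have h4 : ((p : ℝ) ^ (-r)) ^ (Nat.log p n - H) =
          (((p : ℝ) ^ (-r)) ^ H)⁻¹ * ((p : ℝ) ^ (-r)) ^ Nat.log p n := by
        conv_rhs => rw [← Nat.add_sub_cancel' (show H ≤ Nat.log p n by lia), pow_add]
        rw [inv_mul_cancel_left₀ (by positivity)]
      refine mul_le_mul_of_nonneg_left ?_ (by linarith)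
      rw [h4]
      calc _ = max M e * (((p : ℝ) ^ (-r)) ^ H)⁻¹ * (p : ℝ)⁻¹ ^ (Nat.log p n - H) *
            ((p : ℝ) ^ (-r)) ^ Nat.log p n := by ring
        _ ≤ _ := mul_le_mul_of_nonneg_right h3 (by positivity)
    have h2 : (n : ℝ) ^ r ≤ (p : ℝ) ^ r * ((p : ℝ) ^ Nat.log p n) ^ r := by
      rw [← Real.mul_rpow hp0.le (by positivity)]
      refine Real.rpow_le_rpow (by positivity) ?_ hr.le
      have := (Nat.lt_pow_succ_log_self hp n).le
      rw [pow_succ'] at this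
      exact_mod_cast this
    rw [dist_zero_right, Real.norm_of_nonneg (by positivity)]
    calc (n : ℝ) ^ r * ‖mahlerCoeff p L f n‖
        ≤ (p : ℝ) ^ r * ((p : ℝ) ^ Nat.log p n) ^ r *
          (K * (e * ((p : ℝ) ^ (-r)) ^ Nat.log p n)) := by gcongr
      _ = (p : ℝ) ^ r * K * e *
          (((p : ℝ) ^ (-r)) ^ Nat.log p n * ((p : ℝ) ^ Nat.log p n) ^ r) := by ring
      _ = ε / 2 := by
        rw [rpow_neg_pow_mul, mul_one, he]
        field_simp
      _ < ε := by linarith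
  · obtain ⟨h, hh⟩ := (hf ε hε).exists
    exact ⟨h, hh.mono (mul_le_of_le_one_right hε.le (pow_le_one₀ hρ.le hρ1))⟩

lemma IsCr.continuous {r : ℝ} (hr : 0 < r) {f : ℤ_[p] → L} (hf : IsCr p L r f) :
    Continuous f := by
  obtain ⟨d, hd⟩ := exists_nat_gt r
  refine continuous_of_approxOn (d := d) fun ε hε ↦ ?_
  obtain ⟨h, hh⟩ := (hf.eventually_approxOn hr (by linarith : r < d + 1) hε).exists
  exact ⟨h, hh.mono (mul_le_of_le_one_right hε.le
    (pow_le_one₀ (rpow_neg_prime_pos p r).le (rpow_neg_prime_lt_one p hr).le))⟩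

end Converse

section Homogeneous

variable {p : ℕ} [Fact p.Prime]
variable {L : Type} [NontriviallyNormedField L] [NormedAlgebra ℚ_[p] L]

/-- The character `x ↦ q^{val x} x^d` of `ℚ_p^×`. -/
def twist (q : L) (d : ℕ) (x : ℚ_[p]) : L := q ^ x.valuation * iotaL p L x ^ d

lemma twist_one (q : L) (d : ℕ) : twist q d (1 : ℚ_[p]) = 1 := by
  simp [twist, iotaL]

lemma twist_mul {q : L} (hq : q ≠ 0) (d : ℕ) {x y : ℚ_[p]} (hx : x ≠ 0) (hy : y ≠ 0) :
    twist q d (x * y) = twist q d x * twist q d y := by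
  rw [twist, twist, twist, Padic.valuation_mul hx hy, zpow_add₀ hq, iotaL, map_mul]
  ring

lemma norm_twist (q : L) (d : ℕ) (x : ℚ_[p]) : ‖twist q d x‖ = ‖q‖ ^ x.valuation * ‖x‖ ^ d := by
  rw [twist, norm_mul, norm_zpow, norm_pow, norm_iotaL]

lemma valuation_eq_of_norm_eq {x y : ℚ_[p]} (hx : x ≠ 0) (h : ‖x‖ = ‖y‖) :
    x.valuation = y.valuation := by
  have hy : y ≠ 0 := by
    rw [← norm_ne_zero_iff, ← h]
    exact norm_ne_zero_iff.mpr hx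
  have hp : 1 < (p : ℝ) := by exact_mod_cast (Fact.out : p.Prime).one_lt
  rw [Padic.norm_eq_zpow_neg_valuation hx, Padic.norm_eq_zpow_neg_valuation hy] at h
  exact neg_injective (zpow_right_injective₀ (by linarith) hp.ne' h)

/-- `F` is homogeneous for the character `twist q d` away from the origin. -/
def IsHomog (q : L) (d : ℕ) (F : ℚ_[p] → ℚ_[p] → L) : Prop :=
  ∀ t x y : ℚ_[p], t ≠ 0 → (x ≠ 0 ∨ y ≠ 0) → F (t * x) (t * y) = twist q d t * F x y

lemma exists_norm_twist_le (q : L) (d : ℕ) {δ R : ℝ} (hδ : 0 < δ) :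
    ∃ K : ℝ, 0 < K ∧ ∀ x : ℚ_[p], δ ≤ ‖x‖ → ‖x‖ ≤ R → ‖twist q d x‖ ≤ K := by
  have hp : 1 < (p : ℝ) := by exact_mod_cast (Fact.out : p.Prime).one_lt
  obtain ⟨N, hN⟩ := pow_unbounded_of_one_lt (max R δ⁻¹) hp
  have hsum : 0 ≤ ∑ n ∈ Finset.Icc (-(N : ℤ)) N, ‖q‖ ^ n * |R| ^ d :=
    Finset.sum_nonneg fun _ _ ↦ by positivity
  refine ⟨(∑ n ∈ Finset.Icc (-(N : ℤ)) N, ‖q‖ ^ n * |R| ^ d) + 1, by linarith, fun x hx hxR ↦ ?_⟩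
  have hx0 : x ≠ 0 := norm_pos_iff.mp (hδ.trans_le hx)
  have h1 : ‖x‖ < (p : ℝ) ^ (N : ℤ) := by
    rw [zpow_natCast]
    exact hxR.trans_lt ((le_max_left _ _).trans_lt hN)
  have h2 : (p : ℝ) ^ (-(N : ℤ)) < ‖x‖ := by
    rw [zpow_neg, zpow_natCast]
    exact (inv_lt_of_inv_lt₀ hδ ((le_max_right _ _).trans_lt hN)).trans_le hx
  rw [Padic.norm_eq_zpow_neg_valuation hx0, zpow_lt_zpow_iff_right₀ hp] at h1 h2
  have h3 : ‖twist q d x‖ ≤ ‖q‖ ^ x.valuation * |R| ^ d := by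
    rw [norm_twist]
    exact mul_le_mul_of_nonneg_left
      (pow_le_pow_left₀ (norm_nonneg _) (hxR.trans (le_abs_self R)) _) (by positivity)
  have h4 := Finset.single_le_sum (f := fun n : ℤ ↦ ‖q‖ ^ n * |R| ^ d)
    (s := Finset.Icc (-(N : ℤ)) N) (fun _ _ ↦ by positivity)
    (Finset.mem_Icc.mpr ⟨by lia, by lia⟩ : x.valuation ∈ _)
  linarith

/-- A homogeneous combination of two affine forms, as a polynomial. -/
lemma exists_homogenization (d : ℕ) (P : Polynomial L) (hP : P.natDegree ≤ d)
    (A₀ A₁ B₀ B₁ : ℚ_[p]) :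
    ∃ Q : Polynomial L, Q.natDegree ≤ d ∧ ∀ z : ℚ_[p], A₀ + z * A₁ ≠ 0 →
      Q.eval (iotaL p L z) = iotaL p L (A₀ + z * A₁) ^ d *
        P.eval (iotaL p L ((B₀ + z * B₁) / (A₀ + z * A₁))) := by
  have hlin (u v : L) : (Polynomial.C v * Polynomial.X + Polynomial.C u).natDegree ≤ 1 :=
    Polynomial.natDegree_linear_le
  refine ⟨∑ i ∈ Finset.range (d + 1), Polynomial.C (P.coeff i) *
    ((Polynomial.C (iotaL p L B₁) * Polynomial.X + Polynomial.C (iotaL p L B₀)) ^ i *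
    (Polynomial.C (iotaL p L A₁) * Polynomial.X + Polynomial.C (iotaL p L A₀)) ^ (d - i)),
    ?_, fun z hz ↦ ?_⟩
  · refine Polynomial.natDegree_sum_le_of_forall_le _ _ fun i hi ↦ ?_
    refine (Polynomial.natDegree_C_mul_le _ _).trans (Polynomial.natDegree_mul_le.trans ?_)
    have h1 := Polynomial.natDegree_pow_le_of_le i (hlin (iotaL p L B₀) (iotaL p L B₁))
    have h2 := Polynomial.natDegree_pow_le_of_le (d - i) (hlin (iotaL p L A₀) (iotaL p L A₁))
    have := Finset.mem_range.mp hi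
    lia
  · rw [Polynomial.eval_finsetSum, Polynomial.eval_eq_sum_range' (Nat.lt_succ_of_le hP),
      Finset.mul_sum]
    refine Finset.sum_congr rfl fun i hi ↦ ?_
    have hi' : i ≤ d := Nat.lt_succ_iff.mp (Finset.mem_range.mp hi)
    have hA : iotaL p L (A₀ + z * A₁) ≠ 0 := by
      rw [← norm_ne_zero_iff, norm_iotaL]
      exact norm_ne_zero_iff.mpr hz
    have hlinA : iotaL p L A₁ * iotaL p L z + iotaL p L A₀ = iotaL p L (A₀ + z * A₁) := by
      simp [iotaL, add_comm, mul_comm]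
    have hlinB : iotaL p L B₁ * iotaL p L z + iotaL p L B₀ = iotaL p L (B₀ + z * B₁) := by
      simp [iotaL, add_comm, mul_comm]
    have hdiv : iotaL p L ((B₀ + z * B₁) / (A₀ + z * A₁)) =
        iotaL p L (B₀ + z * B₁) / iotaL p L (A₀ + z * A₁) := map_div₀ (algebraMap ℚ_[p] L) _ _
    simp only [Polynomial.eval_mul, Polynomial.eval_C, Polynomial.eval_pow, Polynomial.eval_add,
      Polynomial.eval_X, hlinA, hlinB, hdiv, div_pow]
    rw [← Nat.sub_add_cancel hi', pow_add, Nat.add_sub_cancel]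
    field_simp

lemma norm_eq_of_norm_sub_lt {x y : ℚ_[p]} (h : ‖x - y‖ < ‖y‖) : ‖x‖ = ‖y‖ := by
  have := IsUltrametricDist.norm_add_eq_max_of_norm_ne_norm h.ne
  rwa [sub_add_cancel, max_eq_right h.le] at this

/-- Transport of a local approximation through a fractional linear change of variable on a ball
where the denominator has constant norm. -/
lemma exists_polynomial_near_twist_mul {q : L} {d h : ℕ} {ε : ℝ} {φ : ℤ_[p] → L}
    (hφ : ApproxOn d h ε φ) (A₀ A₁ B₀ B₁ : ℚ_[p]) (s : Set ℤ_[p]) {a : ℤ_[p]}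
    (ha : A₀ + (a : ℚ_[p]) * A₁ ≠ 0)
    (hA : ∀ z ∈ s, ‖A₀ + (z : ℚ_[p]) * A₁‖ = ‖A₀ + (a : ℚ_[p]) * A₁‖)
    (F : ℤ_[p] → L) (w : ℤ_[p])
    (hF : ∀ z ∈ s, ∃ w' : ℤ_[p], (w' : ℚ_[p]) = (B₀ + (z : ℚ_[p]) * B₁) / (A₀ + (z : ℚ_[p]) * A₁) ∧
      ‖w' - w‖ ≤ (p : ℝ)⁻¹ ^ h ∧ F z = twist q d (A₀ + (z : ℚ_[p]) * A₁) * φ w') :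
    ∃ Q : Polynomial L, Q.natDegree ≤ d ∧
      ∀ z ∈ s, ‖F z - Q.eval (iotaL p L (z : ℚ_[p]))‖ ≤
        ‖twist q d (A₀ + (a : ℚ_[p]) * A₁)‖ * ε := by
  obtain ⟨P, hPd, hP⟩ := hφ w
  obtain ⟨Q, hQd, hQ⟩ := exists_homogenization d P hPd A₀ A₁ B₀ B₁
  refine ⟨Polynomial.C (q ^ (A₀ + (a : ℚ_[p]) * A₁).valuation) * Q,
    (Polynomial.natDegree_C_mul_le _ _).trans hQd, fun z hz ↦ ?_⟩
  obtain ⟨w', hw', hww', hFz⟩ := hF z hz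
  have hz0 : A₀ + (z : ℚ_[p]) * A₁ ≠ 0 := by
    rw [← norm_ne_zero_iff, hA z hz]
    exact norm_ne_zero_iff.mpr ha
  have hval := valuation_eq_of_norm_eq hz0 (hA z hz)
  rw [hFz, Polynomial.eval_mul, Polynomial.eval_C, hQ z hz0, ← mul_assoc, ← hval, ← hw']
  change ‖twist q d (A₀ + (z : ℚ_[p]) * A₁) * φ w' - twist q d (A₀ + (z : ℚ_[p]) * A₁) * _‖ ≤ _
  rw [← mul_sub, norm_mul, norm_twist, norm_twist, hval, hA z hz]
  exact mul_le_mul_of_nonneg_left (hP w' hww') (by positivity)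

/-- A homogeneous function near a point `(x, y)` in the two standard charts of `ℙ¹`. -/
lemma IsHomog.eq_of_norm_le {q : L} {d : ℕ} {F : ℚ_[p] → ℚ_[p] → L} (hF : IsHomog q d F)
    {x y : ℚ_[p]} (hx : x ≠ 0) (hxy : ‖y‖ ≤ ‖x‖) :
    ∃ w : ℤ_[p], (w : ℚ_[p]) = y / x ∧ F x y = twist q d x * F 1 w := by
  refine ⟨⟨y / x, ?_⟩, rfl, ?_⟩
  · rw [norm_div]
    exact div_le_one_of_le₀ hxy (norm_nonneg _)
  · rw [← hF x 1 _ hx (Or.inl one_ne_zero), mul_one, mul_div_cancel₀ _ hx]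

lemma IsHomog.eq_of_norm_lt {q : L} {d : ℕ} {F : ℚ_[p] → ℚ_[p] → L} (hF : IsHomog q d F)
    {x y : ℚ_[p]} (hxy : ‖x‖ < ‖y‖) :
    ∃ w : ℤ_[p], (w : ℚ_[p]) = x / p / y ∧ F x y = twist q d y * F (p * w) 1 := by
  have hy : y ≠ 0 := norm_pos_iff.mp ((norm_nonneg _).trans_lt hxy)
  have hp0 : (p : ℚ_[p]) ≠ 0 := by exact_mod_cast (Fact.out : p.Prime).ne_zero
  have h1 : ‖x / y‖ ≤ (p : ℝ)⁻¹ := by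
    have h2 : ‖x / y‖ < 1 := by
      rw [norm_div]
      exact (div_lt_one (norm_pos_iff.mpr hy)).mpr hxy
    have := (Padic.norm_le_pow_iff_norm_lt_pow_add_one (x / y) (-1)).mpr (by simpa using h2)
    simpa using this
  refine ⟨⟨x / p / y, ?_⟩, rfl, ?_⟩
  · rw [div_right_comm, norm_div, Padic.norm_p]
    exact div_le_one_of_le₀ h1 (prime_inv_pos p).le
  · rw [← hF y _ 1 hy (Or.inr one_ne_zero), mul_one]
    congr 1
    change x = y * (p * (x / p / y))
    field_simp

set_option maxHeartbeats 1000000 in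
lemma exists_transfer (q : L) (d : ℕ) {u₀ u₁ v₀ v₁ : ℚ_[p]} (hD : u₀ * v₁ - u₁ * v₀ ≠ 0) :
    ∃ (h₀ : ℕ) (K : ℝ), 0 < K ∧ ∀ F : ℚ_[p] → ℚ_[p] → L, IsHomog q d F →
      (∀ (h : ℕ) (ε : ℝ), 0 ≤ ε → ApproxOn d h ε (fun z : ℤ_[p] ↦ F (p * z) 1) →
        ApproxOn d h ε (fun z : ℤ_[p] ↦ F 1 z) →
        ApproxOn d (h + h₀) (K * ε) (fun z : ℤ_[p] ↦ F (u₀ + z * v₀) (u₁ + z * v₁))) ∧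
      ∀ C : ℝ, (∀ z : ℤ_[p], ‖F (p * z) 1‖ ≤ C) → (∀ z : ℤ_[p], ‖F 1 z‖ ≤ C) →
        ∀ z : ℤ_[p], ‖F (u₀ + z * v₀) (u₁ + z * v₁)‖ ≤ K * C := by
  set D := u₀ * v₁ - u₁ * v₀ with hDdef
  set R := max (max ‖u₀‖ ‖u₁‖) (max ‖v₀‖ ‖v₁‖) with hR
  have hu₀ : ‖u₀‖ ≤ R := (le_max_left _ _).trans (le_max_left _ _)
  have hu₁ : ‖u₁‖ ≤ R := (le_max_right _ _).trans (le_max_left _ _)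
  have hv₀ : ‖v₀‖ ≤ R := (le_max_left _ _).trans (le_max_right _ _)
  have hv₁ : ‖v₁‖ ≤ R := (le_max_right _ _).trans (le_max_right _ _)
  have hD0 : 0 < ‖D‖ := norm_pos_iff.mpr hD
  have hR0 : 0 < R := by
    refine lt_of_le_of_ne ((norm_nonneg _).trans hu₀) fun h0 ↦ hD ?_
    rw [← h0, norm_le_zero_iff] at hu₀ hu₁
    simp [hDdef, hu₀, hu₁]
  have hp : 1 < (p : ℝ) := by exact_mod_cast (Fact.out : p.Prime).one_lt
  set δ := ‖D‖ / R with hδdef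
  have hδ : 0 < δ := by positivity
  obtain ⟨K, hK0, hK⟩ := exists_norm_twist_le (p := p) q d (R := R) hδ
  have hx_le (u v : ℚ_[p]) (hu : ‖u‖ ≤ R) (hv : ‖v‖ ≤ R) (z : ℤ_[p]) : ‖u + z * v‖ ≤ R := by
    refine (IsUltrametricDist.norm_add_le_max _ _).trans (max_le hu ?_)
    rw [norm_mul]
    exact (mul_le_of_le_one_left (norm_nonneg _) (PadicInt.norm_le_one z)).trans hv
  have hδ_le (z : ℤ_[p]) : δ ≤ max ‖u₀ + z * v₀‖ ‖u₁ + z * v₁‖ := by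
    rw [hδdef, div_le_iff₀ hR0]
    have h1 : D = (u₀ + z * v₀) * v₁ - (u₁ + z * v₁) * v₀ := by rw [hDdef]; ring
    rw [h1]
    refine (norm_sub_le_max_norm _ _).trans (max_le ?_ ?_)
    · rw [norm_mul]
      exact mul_le_mul (le_max_left _ _) hv₁ (norm_nonneg _) (by positivity)
    · rw [norm_mul]
      exact mul_le_mul (le_max_right _ _) hv₀ (norm_nonneg _) (by positivity)
  have ht : Tendsto (fun t : ℕ ↦ (p : ℝ)⁻¹ ^ t) atTop (𝓝 0) :=
    tendsto_pow_atTop_nhds_zero_of_lt_one (prime_inv_pos p).le (prime_inv_lt_one p)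
  obtain ⟨h₀, hh₀, hh₀'⟩ := ((ht.eventually_lt_const (show 0 < δ / R by positivity)).and
    (ht.eventually_le_const (show 0 < δ * δ / (p * ‖D‖) by positivity))).exists
  rw [lt_div_iff₀ hR0] at hh₀
  rw [le_div_iff₀ (by positivity)] at hh₀'
  have hKsup : ∀ F : ℚ_[p] → ℚ_[p] → L, IsHomog q d F → ∀ C : ℝ,
      (∀ z : ℤ_[p], ‖F (p * z) 1‖ ≤ C) → (∀ z : ℤ_[p], ‖F 1 z‖ ≤ C) →
        ∀ z : ℤ_[p], ‖F (u₀ + z * v₀) (u₁ + z * v₁)‖ ≤ K * C := by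
    intro F hF C h1 h2 z
    have hδz := hδ_le z
    rcases le_or_gt ‖u₁ + z * v₁‖ ‖u₀ + z * v₀‖ with hxy | hxy
    · rw [max_eq_left hxy] at hδz
      obtain ⟨w, -, hw⟩ := hF.eq_of_norm_le (norm_pos_iff.mp (hδ.trans_le hδz)) hxy
      rw [hw, norm_mul]
      exact mul_le_mul (hK _ hδz (hx_le _ _ hu₀ hv₀ z)) (h2 w) (norm_nonneg _) hK0.le
    · rw [max_eq_right hxy.le] at hδz
      obtain ⟨w, -, hw⟩ := hF.eq_of_norm_lt hxy
      rw [hw, norm_mul]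
      exact mul_le_mul (hK _ hδz (hx_le _ _ hu₁ hv₁ z)) (h1 w) (norm_nonneg _) hK0.le
  refine ⟨h₀, K, hK0, fun F hF ↦ ⟨fun h ε hε h1 h2 a ↦ ?_, hKsup F hF⟩⟩
  have hball {z : ℤ_[p]} (hz : ‖z - a‖ ≤ (p : ℝ)⁻¹ ^ (h + h₀)) (u v : ℚ_[p]) (hv : ‖v‖ ≤ R) :
      ‖(u + z * v) - (u + a * v)‖ < δ := by
    have h3 : (u + z * v) - (u + a * v) = ((z - a : ℤ_[p]) : ℚ_[p]) * v := by
      push_cast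
      ring
    rw [h3, norm_mul]
    refine (mul_le_mul hz hv (norm_nonneg _) (by positivity)).trans_lt (lt_of_le_of_lt ?_ hh₀)
    refine mul_le_mul_of_nonneg_right ?_ hR0.le
    exact pow_le_pow_of_le_one (prime_inv_pos p).le (prime_inv_lt_one p).le (Nat.le_add_left _ _)
  have hdist {z : ℤ_[p]} (hz : ‖z - a‖ ≤ (p : ℝ)⁻¹ ^ (h + h₀)) {N : ℝ} (hN : δ ≤ N) :
      p * ‖D‖ * ‖z - a‖ ≤ (p : ℝ)⁻¹ ^ h * (N * N) := by
    calc p * ‖D‖ * ‖z - a‖ ≤ p * ‖D‖ * (p : ℝ)⁻¹ ^ (h + h₀) := by gcongr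
      _ = (p : ℝ)⁻¹ ^ h * ((p : ℝ)⁻¹ ^ h₀ * (p * ‖D‖)) := by rw [pow_add]; ring
      _ ≤ (p : ℝ)⁻¹ ^ h * (δ * δ) := by gcongr
      _ ≤ _ := mul_le_mul_of_nonneg_left (mul_self_le_mul_self hδ.le hN) (by positivity)
  have hδa := hδ_le a
  rcases le_or_gt ‖u₁ + a * v₁‖ ‖u₀ + a * v₀‖ with hxy | hxy
  · rw [max_eq_left hxy] at hδa
    have ha0 : u₀ + a * v₀ ≠ 0 := norm_pos_iff.mp (hδ.trans_le hδa)
    have hA : ∀ z ∈ {z : ℤ_[p] | ‖z - a‖ ≤ (p : ℝ)⁻¹ ^ (h + h₀)},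
        ‖u₀ + z * v₀‖ = ‖u₀ + a * v₀‖ := fun z hz ↦
      norm_eq_of_norm_sub_lt ((hball hz u₀ v₀ hv₀).trans_le hδa)
    obtain ⟨w, hw, -⟩ := hF.eq_of_norm_le ha0 hxy
    have hloc : ∀ z ∈ {z : ℤ_[p] | ‖z - a‖ ≤ (p : ℝ)⁻¹ ^ (h + h₀)}, ∃ w' : ℤ_[p],
        (w' : ℚ_[p]) = (u₁ + z * v₁) / (u₀ + z * v₀) ∧ ‖w' - w‖ ≤ (p : ℝ)⁻¹ ^ h ∧
        F (u₀ + z * v₀) (u₁ + z * v₁) = twist q d (u₀ + (z : ℚ_[p]) * v₀) * F 1 w' := by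
      intro z hz
      have hz0 : u₀ + z * v₀ ≠ 0 := by
        rw [← norm_ne_zero_iff, hA z hz]
        exact norm_ne_zero_iff.mpr ha0
      have hyz : ‖u₁ + z * v₁‖ ≤ ‖u₀ + z * v₀‖ := by
        rw [hA z hz, ← sub_add_cancel (u₁ + z * v₁) (u₁ + a * v₁)]
        exact (IsUltrametricDist.norm_add_le_max _ _).trans
          (max_le ((hball hz u₁ v₁ hv₁).le.trans hδa) hxy)
      obtain ⟨w', hw', hFw'⟩ := hF.eq_of_norm_le hz0 hyz
      refine ⟨w', hw', ?_, hFw'⟩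
      rw [PadicInt.norm_def, PadicInt.coe_sub, hw', hw]
      have h5 : (u₁ + z * v₁) / (u₀ + z * v₀) - (u₁ + a * v₁) / (u₀ + a * v₀) =
          ((z - a : ℤ_[p]) : ℚ_[p]) * D / ((u₀ + z * v₀) * (u₀ + a * v₀)) := by
        rw [div_sub_div _ _ hz0 ha0, PadicInt.coe_sub, hDdef]
        congr 1
        ring
      rw [h5, norm_div, norm_mul, norm_mul, hA z hz, div_le_iff₀ (by positivity)]
      refine le_trans ?_ (hdist hz hδa)
      have : ‖((z - a : ℤ_[p]) : ℚ_[p])‖ = ‖z - a‖ := rfl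
      rw [this, mul_comm, mul_assoc]
      exact le_mul_of_one_le_left (by positivity) hp.le
    obtain ⟨Q, hQd, hQ⟩ := exists_polynomial_near_twist_mul (q := q) h2 u₀ v₀ u₁ v₁
      {z : ℤ_[p] | ‖z - a‖ ≤ (p : ℝ)⁻¹ ^ (h + h₀)} ha0 hA _ w hloc
    exact ⟨Q, hQd, fun z hz ↦ (hQ z hz).trans
      (mul_le_mul_of_nonneg_right (hK _ hδa (hx_le _ _ hu₀ hv₀ a)) hε)⟩
  · rw [max_eq_right hxy.le] at hδa
    have ha0 : u₁ + a * v₁ ≠ 0 := norm_pos_iff.mp (hδ.trans_le hδa)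
    have hA : ∀ z ∈ {z : ℤ_[p] | ‖z - a‖ ≤ (p : ℝ)⁻¹ ^ (h + h₀)},
        ‖u₁ + z * v₁‖ = ‖u₁ + a * v₁‖ := fun z hz ↦
      norm_eq_of_norm_sub_lt ((hball hz u₁ v₁ hv₁).trans_le hδa)
    have hsplit (z : ℤ_[p]) : (u₀ + z * v₀) / p = u₀ / p + z * (v₀ / p) := by ring
    obtain ⟨w, hw, -⟩ := hF.eq_of_norm_lt hxy
    have hloc : ∀ z ∈ {z : ℤ_[p] | ‖z - a‖ ≤ (p : ℝ)⁻¹ ^ (h + h₀)}, ∃ w' : ℤ_[p],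
        (w' : ℚ_[p]) = (u₀ / p + z * (v₀ / p)) / (u₁ + z * v₁) ∧ ‖w' - w‖ ≤ (p : ℝ)⁻¹ ^ h ∧
        F (u₀ + z * v₀) (u₁ + z * v₁) = twist q d (u₁ + (z : ℚ_[p]) * v₁) * F (p * w') 1 := by
      intro z hz
      have hz0 : u₁ + z * v₁ ≠ 0 := by
        rw [← norm_ne_zero_iff, hA z hz]
        exact norm_ne_zero_iff.mpr ha0
      have hyz : ‖u₀ + z * v₀‖ < ‖u₁ + z * v₁‖ := by
        rw [hA z hz, ← sub_add_cancel (u₀ + z * v₀) (u₀ + a * v₀)]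
        exact (IsUltrametricDist.norm_add_le_max _ _).trans_lt
          (max_lt ((hball hz u₀ v₀ hv₀).trans_le hδa) hxy)
      obtain ⟨w', hw', hFw'⟩ := hF.eq_of_norm_lt hyz
      refine ⟨w', by rw [hw', hsplit], ?_, hFw'⟩
      have hp0 : (p : ℚ_[p]) ≠ 0 := by exact_mod_cast (Fact.out : p.Prime).ne_zero
      rw [PadicInt.norm_def, PadicInt.coe_sub, hw', hw]
      have h5 : (u₀ + z * v₀) / p / (u₁ + z * v₁) - (u₀ + a * v₀) / p / (u₁ + a * v₁) =
          -(((z - a : ℤ_[p]) : ℚ_[p]) * D) / (p * ((u₁ + z * v₁) * (u₁ + a * v₁))) := by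
        rw [div_div, div_div, div_sub_div _ _ (mul_ne_zero hp0 hz0) (mul_ne_zero hp0 ha0),
          PadicInt.coe_sub, hDdef, div_eq_div_iff
            (mul_ne_zero (mul_ne_zero hp0 hz0) (mul_ne_zero hp0 ha0))
            (mul_ne_zero hp0 (mul_ne_zero hz0 ha0))]
        ring
      rw [h5, norm_div, norm_neg, norm_mul, norm_mul, norm_mul, hA z hz, Padic.norm_p,
        div_le_iff₀ (by positivity), mul_left_comm, inv_mul_eq_div, le_div_iff₀ (by linarith)]
      refine le_trans (le_of_eq ?_) (hdist hz hδa)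
      have : ‖((z - a : ℤ_[p]) : ℚ_[p])‖ = ‖z - a‖ := rfl
      rw [this]
      ring
    obtain ⟨Q, hQd, hQ⟩ := exists_polynomial_near_twist_mul (q := q) h1 u₁ v₁ (u₀ / p) (v₀ / p)
      {z : ℤ_[p] | ‖z - a‖ ≤ (p : ℝ)⁻¹ ^ (h + h₀)} ha0 hA _ w hloc
    exact ⟨Q, hQd, fun z hz ↦ (hQ z hz).trans
      (mul_le_mul_of_nonneg_right (hK _ hδa (hx_le _ _ hu₁ hv₁ a)) hε)⟩

end Homogeneous

section Banach

variable {p : ℕ} [Fact p.Prime]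
variable {L : Type} [NontriviallyNormedField L]

lemma crNorm_smul (r : ℝ) (c : L) (f : ℤ_[p] → L) :
    crNorm p L r (c • f) = ‖c‖ * crNorm p L r f := by
  rw [crNorm, crNorm, Real.mul_iSup_of_nonneg (norm_nonneg c)]
  refine iSup_congr fun n ↦ ?_
  rw [mahlerCoeff_smul, norm_mul]
  ring

variable [NormedAlgebra ℚ_[p] L]

/-- Homogeneous functions with `C^r` charts are `C^r` along every parametrized line avoiding the
origin, with a uniform bound. -/
lemma exists_isCr_comp [IsUltrametricDist L] [CompleteSpace L] (q : L) {r : ℝ} (hr : 0 < r) {d : ℕ}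
    (hrd : r < d + 1) {u₀ u₁ v₀ v₁ : ℚ_[p]} (hD : u₀ * v₁ - u₁ * v₀ ≠ 0) :
    ∃ K : ℝ, 0 < K ∧ ∀ F : ℚ_[p] → ℚ_[p] → L, IsHomog q d F →
      IsCr p L r (fun z : ℤ_[p] ↦ F (p * z) 1) → IsCr p L r (fun z : ℤ_[p] ↦ F 1 z) →
      IsCr p L r (fun z : ℤ_[p] ↦ F (u₀ + z * v₀) (u₁ + z * v₁)) ∧
      crNorm p L r (fun z : ℤ_[p] ↦ F (u₀ + z * v₀) (u₁ + z * v₁)) ≤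
        K * max (crNorm p L r (fun z : ℤ_[p] ↦ F (p * z) 1))
          (crNorm p L r (fun z : ℤ_[p] ↦ F 1 z)) := by
  obtain ⟨h₀, K, hK, hT⟩ := exists_transfer q d hD
  obtain ⟨K', hK', hN⟩ := exists_crNorm_le p L hr hrd
  set ρ := (p : ℝ) ^ (-r) with hρ
  have hρ0 : 0 < ρ := rpow_neg_prime_pos p r
  have hρ1 : ρ < 1 := rpow_neg_prime_lt_one p hr
  refine ⟨K' * (K * (ρ ^ h₀)⁻¹), by positivity, fun F hF h1 h2 ↦ ?_⟩
  obtain ⟨hT1, hT2⟩ := hT F hF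
  set C := max (crNorm p L r (fun z : ℤ_[p] ↦ F (p * z) 1))
    (crNorm p L r (fun z : ℤ_[p] ↦ F 1 z)) with hC
  have hC0 : 0 ≤ C := (crNorm_nonneg r _).trans (le_max_left _ _)
  have hsup := hT2 C (fun z ↦ (h1.norm_le hr z).trans (le_max_left _ _))
    (fun z ↦ (h2.norm_le hr z).trans (le_max_right _ _))
  refine ⟨isCr_of_approxOn hr hrd hsup fun ε hε ↦ ?_, ?_⟩
  · have hε' : 0 < ε * ρ ^ h₀ / K := by positivity
    have := (h1.eventually_approxOn hr hrd hε').and (h2.eventually_approxOn hr hrd hε')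
    filter_upwards [(tendsto_sub_atTop_nat h₀).eventually this,
      eventually_ge_atTop h₀] with h hh hle
    have h3 := hT1 (h - h₀) _ (by positivity) hh.1 hh.2
    rw [Nat.sub_add_cancel hle] at h3
    refine h3.mono (le_of_eq ?_)
    rw [← hρ, ← Nat.sub_add_cancel hle, pow_add, Nat.add_sub_cancel]
    field_simp
  · rw [mul_assoc]
    refine hN _ _ (fun z ↦ (hsup z).trans ?_) fun h ↦ ?_
    · rw [mul_right_comm]
      refine le_mul_of_one_le_right (by positivity) (one_le_inv₀ (by positivity) |>.mpr ?_)
      exact pow_le_one₀ hρ0.le hρ1.le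
    · rcases le_or_gt h₀ h with hle | hlt
      · have h3 := hT1 (h - h₀) (C * ρ ^ (h - h₀)) (by positivity)
          ((h1.approxOn hr hrd _).mono
            (mul_le_mul_of_nonneg_right (le_max_left _ _) (by positivity)))
          ((h2.approxOn hr hrd _).mono
            (mul_le_mul_of_nonneg_right (le_max_right _ _) (by positivity)))
        rw [Nat.sub_add_cancel hle] at h3
        refine h3.mono (le_of_eq ?_)
        rw [← Nat.sub_add_cancel hle, pow_add, Nat.add_sub_cancel]
        field_simp
      · refine ApproxOn.of_norm_le fun z ↦ (hsup z).trans ?_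
        have h4 : 1 ≤ (ρ ^ h₀)⁻¹ * ρ ^ h := by
          rw [inv_mul_eq_div, one_le_div (by positivity)]
          exact pow_le_pow_of_le_one hρ0.le hρ1.le hlt.le
        calc K * C ≤ K * C * ((ρ ^ h₀)⁻¹ * ρ ^ h) := le_mul_of_one_le_right (by positivity) h4
          _ = _ := by ring

variable {k : ℕ} {α β : L}

/-- The extension of `f ∈ B(α)` to a homogeneous function on `ℚ_p² ∖ {0}`. -/
def homFun (k : ℕ) (α β : L) (f : ℚ_[p] → L) (x y : ℚ_[p]) : L :=
  if y = 0 then twist (α * (p : L) / β) (k - 2) x * ext2 p L k α β f 0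
  else twist (α * (p : L) / β) (k - 2) y * f (x / y)

lemma isHomog_homFun (hq : α * (p : L) / β ≠ 0) (f : ℚ_[p] → L) :
    IsHomog (α * (p : L) / β) (k - 2) (homFun k α β f) := by
  intro t x y ht hxy
  by_cases hy : y = 0
  · have hx : x ≠ 0 := hxy.resolve_right (not_not_intro hy)
    simp only [homFun, hy, mul_zero, if_true]
    rw [twist_mul hq _ ht hx, mul_assoc]
  · simp only [homFun, hy, mul_ne_zero ht hy, if_false]
    rw [twist_mul hq _ ht hy, mul_assoc, mul_div_mul_left _ _ ht]

lemma MemB.ext2_spec {f : ℚ_[p] → L} (hf : MemB p L k α β f) :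
    Ext2 p L k α β f (ext2 p L k α β f) := by
  rw [ext2, dif_pos hf.2]
  exact hf.2.choose_spec

lemma homFun_one_right (f : ℚ_[p] → L) (z : ℚ_[p]) : homFun k α β f z 1 = f z := by
  simp [homFun, twist_one]

lemma homFun_one_left {f : ℚ_[p] → L} (hf : MemB p L k α β f) (z : ℤ_[p]) :
    homFun k α β f 1 (z : ℚ_[p]) = ext2 p L k α β f z := by
  by_cases hz : z = 0
  · simp [homFun, hz, twist_one]
  · have hz' : (z : ℚ_[p]) ≠ 0 := fun h ↦ hz (Subtype.ext h)
    rw [homFun, if_neg hz', hf.ext2_spec.2 z hz, one_div]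
    rfl

lemma MemB.add {f g : ℚ_[p] → L} (hf : MemB p L k α β f) (hg : MemB p L k α β g) :
    MemB p L k α β (f + g) := by
  refine ⟨hf.1.add hg.1, ext2 p L k α β f + ext2 p L k α β g,
    hf.ext2_spec.1.add hg.ext2_spec.1, fun z hz ↦ ?_⟩
  rw [Pi.add_apply, hf.ext2_spec.2 z hz, hg.ext2_spec.2 z hz, Pi.add_apply, mul_add]

lemma MemB.smul {f : ℚ_[p] → L} (c : L) (hf : MemB p L k α β f) : MemB p L k α β (c • f) := by
  refine ⟨hf.1.const_smul c, c • ext2 p L k α β f, hf.ext2_spec.1.const_smul c, fun z hz ↦ ?_⟩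
  rw [Pi.smul_apply, hf.ext2_spec.2 z hz, Pi.smul_apply, smul_eq_mul, smul_eq_mul]
  ring

lemma memB_zero : MemB p L k α β 0 := by
  have h0 : IsCr p L (valL p L α) 0 := by
    have h1 (n : ℕ) : mahlerCoeff p L 0 n = 0 := by simp [mahlerCoeff]
    refine ⟨by simp [h1], fun z ↦ ?_⟩
    simp [h1]
  exact ⟨h0, 0, h0, fun z _ ↦ by simp⟩

/-- A matrix with nonzero determinant maps nonzero vectors to nonzero vectors. -/
lemma adjugate_ne_zero {m : Matrix (Fin 2) (Fin 2) ℚ_[p]} (hm : det2 p m ≠ 0) {x y : ℚ_[p]}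
    (hxy : x ≠ 0 ∨ y ≠ 0) :
    m 1 1 * x - m 0 1 * y ≠ 0 ∨ -(m 1 0) * x + m 0 0 * y ≠ 0 := by
  by_contra! h
  have hx : det2 p m * x = 0 := by
    rw [det2]
    linear_combination m 0 0 * h.1 + m 0 1 * h.2
  have hy : det2 p m * y = 0 := by
    rw [det2]
    linear_combination m 1 0 * h.1 + m 1 1 * h.2
  exact hxy.elim (fun h0 ↦ mul_ne_zero hm h0 hx) (fun h0 ↦ mul_ne_zero hm h0 hy)

lemma gAct_eq_homFun {m : Matrix (Fin 2) (Fin 2) ℚ_[p]} (hm : det2 p m ≠ 0) (f : ℚ_[p] → L)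
    (z : ℚ_[p]) : gAct p L k α β m f z = α ^ (-(det2 p m).valuation) *
      homFun k α β f (m 1 1 * z - m 0 1) (-(m 1 0) * z + m 0 0) := by
  rw [gAct, homFun]
  split_ifs with h
  · have hc : m 1 0 ≠ 0 := by
      intro hc
      apply hm
      rw [hc, neg_zero, zero_mul, zero_add] at h
      rw [det2, hc, h]
      ring
    have hz : m 1 1 * z - m 0 1 = det2 p m / m 1 0 := by
      rw [eq_div_iff hc, det2]
      linear_combination -(m 1 1) * h
    rw [hz, twist]
    ring
  · rw [twist]
    ring

lemma isHomog_comp {q : L} {d : ℕ} {F : ℚ_[p] → ℚ_[p] → L} (hF : IsHomog q d F)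
    {m : Matrix (Fin 2) (Fin 2) ℚ_[p]} (hm : det2 p m ≠ 0) (c : L) :
    IsHomog q d fun x y ↦ c * F (m 1 1 * x - m 0 1 * y) (-(m 1 0) * x + m 0 0 * y) := by
  intro t x y ht hxy
  have h := hF t _ _ ht (adjugate_ne_zero hm hxy)
  dsimp only
  rw [mul_left_comm (twist q d t), ← h]
  congr 2 <;> ring

/-- The dehomogenization of a homogeneous function with `C^r` charts. -/
lemma IsHomog.ext2 {F : ℚ_[p] → ℚ_[p] → L} (hF : IsHomog (α * (p : L) / β) (k - 2) F)
    (h2 : IsCr p L (valL p L α) (fun z : ℤ_[p] ↦ F 1 z)) :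
    Ext2 p L k α β (fun z ↦ F z 1) (fun z : ℤ_[p] ↦ F 1 z) := by
  refine ⟨h2, fun z hz ↦ ?_⟩
  have hz' : (z : ℚ_[p]) ≠ 0 := fun h ↦ hz (Subtype.ext h)
  have := hF z (z : ℚ_[p])⁻¹ 1 hz' (Or.inr one_ne_zero)
  rw [mul_inv_cancel₀ hz', mul_one] at this
  exact this

variable [IsUltrametricDist L]

lemma Ext2.ext2_eq (hr : 0 < valL p L α) {f : ℚ_[p] → L} {g : ℤ_[p] → L}
    (hg : Ext2 p L k α β f g) : ext2 p L k α β f = g := by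
  have hex : ∃ g, Ext2 p L k α β f g := ⟨g, hg⟩
  have hg' : Ext2 p L k α β f (ext2 p L k α β f) := by
    rw [ext2, dif_pos hex]
    exact hex.choose_spec
  have hne (z : ℤ_[p]) (hz : z ≠ 0) : ext2 p L k α β f z = g z := by
    rw [hg.2 z hz, hg'.2 z hz]
  have hp0 : (p : ℤ_[p]) ≠ 0 := by exact_mod_cast (Fact.out : p.Prime).ne_zero
  have ht : Tendsto (fun n : ℕ ↦ (p : ℤ_[p]) ^ n) atTop (𝓝 0) := by
    refine tendsto_pow_atTop_nhds_zero_of_norm_lt_one ?_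
    rw [PadicInt.norm_p]
    exact prime_inv_lt_one p
  funext z
  by_cases hz : z = 0
  · subst hz
    refine tendsto_nhds_unique (((hg'.1.continuous hr).tendsto 0).comp ht) ?_
    refine (((hg.1.continuous hr).tendsto 0).comp ht).congr fun n ↦ ?_
    exact (hne _ (pow_ne_zero n hp0)).symm
  · exact hne z hz

lemma ext2_add (hr : 0 < valL p L α) {f g : ℚ_[p] → L} (hf : MemB p L k α β f)
    (hg : MemB p L k α β g) :
    ext2 p L k α β (f + g) = ext2 p L k α β f + ext2 p L k α β g := by
  refine Ext2.ext2_eq hr ⟨hf.ext2_spec.1.add hg.ext2_spec.1, fun z hz ↦ ?_⟩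
  rw [Pi.add_apply, hf.ext2_spec.2 z hz, hg.ext2_spec.2 z hz, Pi.add_apply, mul_add]

lemma ext2_smul (hr : 0 < valL p L α) {f : ℚ_[p] → L} (c : L) (hf : MemB p L k α β f) :
    ext2 p L k α β (c • f) = c • ext2 p L k α β f := by
  refine Ext2.ext2_eq hr ⟨hf.ext2_spec.1.const_smul c, fun z hz ↦ ?_⟩
  rw [Pi.smul_apply, hf.ext2_spec.2 z hz, Pi.smul_apply, smul_eq_mul, smul_eq_mul]
  ring

lemma gAct_add (hr : 0 < valL p L α) {f g : ℚ_[p] → L} (hf : MemB p L k α β f)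
    (hg : MemB p L k α β g) (m : Matrix (Fin 2) (Fin 2) ℚ_[p]) :
    gAct p L k α β m (f + g) = gAct p L k α β m f + gAct p L k α β m g := by
  funext z
  simp only [gAct, Pi.add_apply, ext2_add hr hf hg]
  split_ifs <;> ring

lemma gAct_smul (hr : 0 < valL p L α) {f : ℚ_[p] → L} (c : L) (hf : MemB p L k α β f)
    (m : Matrix (Fin 2) (Fin 2) ℚ_[p]) :
    gAct p L k α β m (c • f) = c • gAct p L k α β m f := by
  funext z
  simp only [gAct, Pi.smul_apply, ext2_smul hr c hf, smul_eq_mul]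
  split_ifs <;> ring

lemma homFun_eq (hr : 0 < valL p L α) {F : ℚ_[p] → ℚ_[p] → L}
    (hF : IsHomog (α * (p : L) / β) (k - 2) F)
    (h2 : IsCr p L (valL p L α) (fun z : ℤ_[p] ↦ F 1 z)) {x y : ℚ_[p]} (hxy : x ≠ 0 ∨ y ≠ 0) :
    homFun k α β (fun z ↦ F z 1) x y = F x y := by
  by_cases hy : y = 0
  · have hx : x ≠ 0 := hxy.resolve_right (not_not_intro hy)
    rw [homFun, if_pos hy, (hF.ext2 h2).ext2_eq hr]
    change _ * F 1 ((0 : ℤ_[p]) : ℚ_[p]) = _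
    rw [PadicInt.coe_zero, ← hF x 1 0 hx (Or.inl one_ne_zero), mul_one, mul_zero, hy]
  · rw [homFun, if_neg hy, ← hF y _ 1 hy (Or.inr one_ne_zero), mul_one, mul_div_cancel₀ _ hy]

/-- `GL₂(ℚ_p)` acts on `B(α)` by bounded operators. -/
lemma exists_bNorm_gAct_le [CompleteSpace L] (hα : α ≠ 0) (hβ : β ≠ 0) (hr : 0 < valL p L α)
    (hrd : valL p L α < ((k - 2 : ℕ) : ℝ) + 1) {m : Matrix (Fin 2) (Fin 2) ℚ_[p]}
    (hm : det2 p m ≠ 0) :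
    ∃ K : ℝ, 0 < K ∧ ∀ f, MemB p L k α β f → MemB p L k α β (gAct p L k α β m f) ∧
      bNorm p L k α β (gAct p L k α β m f) ≤ K * bNorm p L k α β f := by
  have hp0 : (p : ℚ_[p]) ≠ 0 := by exact_mod_cast (Fact.out : p.Prime).ne_zero
  have hpL : (p : L) ≠ 0 := by
    have := (algebraMap ℚ_[p] L).injective.ne hp0
    simpa using this
  have hq : α * (p : L) / β ≠ 0 := div_ne_zero (mul_ne_zero hα hpL) hβ
  have hD₁ : -(m 0 1) * (-(m 1 0) * p) - m 0 0 * (m 1 1 * p) ≠ 0 := by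
    have : -(m 0 1) * (-(m 1 0) * p) - m 0 0 * (m 1 1 * p) = -(det2 p m * p) := by
      rw [det2]
      ring
    rw [this]
    exact neg_ne_zero.mpr (mul_ne_zero hm hp0)
  have hD₂ : m 1 1 * m 0 0 - -(m 1 0) * -(m 0 1) ≠ 0 := by
    have : m 1 1 * m 0 0 - -(m 1 0) * -(m 0 1) = det2 p m := by
      rw [det2]
      ring
    rwa [this]
  obtain ⟨K₁, hK₁, hT₁⟩ := exists_isCr_comp (L := L) (α * (p : L) / β) hr hrd hD₁
  obtain ⟨K₂, hK₂, hT₂⟩ := exists_isCr_comp (L := L) (α * (p : L) / β) hr hrd hD₂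
  set c : L := α ^ (-(det2 p m).valuation) with hc
  have hc0 : 0 < ‖c‖ := norm_pos_iff.mpr (zpow_ne_zero _ hα)
  refine ⟨‖c‖ * max K₁ K₂, mul_pos hc0 (lt_max_of_lt_left hK₁), fun f hf ↦ ?_⟩
  have hF := isHomog_homFun (k := k) hq f
  have hG := isHomog_comp hF hm c
  have hch₁ : (fun z : ℤ_[p] ↦ homFun k α β f (p * z) 1) = fun z : ℤ_[p] ↦ f (p * z) :=
    funext fun z ↦ homFun_one_right f _
  have hch₂ : (fun z : ℤ_[p] ↦ homFun k α β f 1 z) = ext2 p L k α β f :=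
    funext fun z ↦ homFun_one_left hf z
  obtain ⟨hC₁, hN₁⟩ := hT₁ _ hF (by rw [hch₁]; exact hf.1) (by rw [hch₂]; exact hf.ext2_spec.1)
  obtain ⟨hC₂, hN₂⟩ := hT₂ _ hF (by rw [hch₁]; exact hf.1) (by rw [hch₂]; exact hf.ext2_spec.1)
  rw [hch₁, hch₂] at hN₁ hN₂
  have hg : gAct p L k α β m f = fun z ↦ c * homFun k α β f (m 1 1 * z - m 0 1 * 1)
      (-(m 1 0) * z + m 0 0 * 1) := by
    funext z
    rw [gAct_eq_homFun hm, mul_one, mul_one]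
  have he₁ : (fun z : ℤ_[p] ↦ gAct p L k α β m f (p * z)) = c • fun z : ℤ_[p] ↦
      homFun k α β f (-(m 0 1) + z * (m 1 1 * p)) (m 0 0 + z * (-(m 1 0) * p)) := by
    funext z
    rw [hg, Pi.smul_apply, smul_eq_mul]
    dsimp only
    congr 2 <;> ring
  have he₂ : (fun z : ℤ_[p] ↦ c * homFun k α β f (m 1 1 * 1 - m 0 1 * z)
      (-(m 1 0) * 1 + m 0 0 * z)) = c • fun z : ℤ_[p] ↦
      homFun k α β f (m 1 1 + z * -(m 0 1)) (-(m 1 0) + z * m 0 0) := by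
    funext z
    rw [Pi.smul_apply, smul_eq_mul]
    congr 2 <;> ring
  have hE := hG.ext2 (by rw [he₂]; exact hC₂.const_smul c)
  rw [← hg, he₂] at hE
  refine ⟨⟨by rw [he₁]; exact hC₁.const_smul c, _, hE⟩, ?_⟩
  have hM : 0 ≤ bNorm p L k α β f := (crNorm_nonneg _ _).trans (le_max_left _ _)
  rw [bNorm, he₁, hE.ext2_eq hr, crNorm_smul, crNorm_smul, mul_assoc]
  refine max_le (mul_le_mul_of_nonneg_left (hN₁.trans ?_) hc0.le)
    (mul_le_mul_of_nonneg_left (hN₂.trans ?_) hc0.le)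
  · exact mul_le_mul_of_nonneg_right (le_max_left _ _) hM
  · exact mul_le_mul_of_nonneg_right (le_max_right _ _) hM

end Banach

section Generators

lemma ne_zero_of_valL_pos {p : ℕ} {L : Type} [NontriviallyNormedField L] {x : L}
    (hx : 0 < valL p L x) : x ≠ 0 := by
  rintro rfl
  simp [valL] at hx

lemma norm_eq_rpow_neg_valL {p : ℕ} [Fact p.Prime] {L : Type} [NontriviallyNormedField L]
    {x : L} (hx : x ≠ 0) : ‖x‖ = (p : ℝ) ^ (-valL p L x) := by
  have hp : 1 < (p : ℝ) := by exact_mod_cast (Fact.out : p.Prime).one_lt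
  rw [valL, neg_neg, Real.rpow_logb (by linarith) hp.ne' (norm_pos_iff.mpr hx)]

variable {p : ℕ} [Fact p.Prime]
variable {L : Type} [NontriviallyNormedField L] [NormedAlgebra ℚ_[p] L]

/-- The homogeneous function `(x, y) ↦ q^{val y} y^{d-j} x^j`, extended by `0` at `y = 0`. -/
def homGen (q : L) (d j : ℕ) (x y : ℚ_[p]) : L :=
  if y = 0 then 0 else q ^ y.valuation * iotaL p L y ^ (d - j) * iotaL p L x ^ j

lemma homGen_mul {q : L} (hq : q ≠ 0) {d j : ℕ} (hj : j ≤ d) {t : ℚ_[p]} (ht : t ≠ 0)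
    (x y : ℚ_[p]) : homGen q d j (t * x) (t * y) = twist q d t * homGen q d j x y := by
  by_cases hy : y = 0
  · simp [homGen, hy]
  · rw [homGen, homGen, if_neg (mul_ne_zero ht hy), if_neg hy, twist, Padic.valuation_mul ht hy,
      zpow_add₀ hq, ← Nat.sub_add_cancel hj, pow_add, Nat.add_sub_cancel]
    simp only [iotaL, map_mul, mul_pow]
    ring

lemma norm_homGen_le {q : L} {s : ℝ} (hq : ‖q‖ = (p : ℝ) ^ (-s)) {d j : ℕ} (hj : j ≤ d)
    (x y : ℚ_[p]) : ‖homGen q d j x y‖ ≤ ‖y‖ ^ (s + d - j) * ‖x‖ ^ j := by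
  by_cases hy : y = 0
  · rw [homGen, if_pos hy, norm_zero]
    positivity
  · have hp : 0 < (p : ℝ) := by exact_mod_cast (Fact.out : p.Prime).pos
    have hy' : 0 < ‖y‖ := norm_pos_iff.mpr hy
    have hval : ‖q‖ ^ y.valuation = ‖y‖ ^ s := by
      rw [hq, Padic.norm_eq_zpow_neg_valuation hy, ← Real.rpow_intCast, ← Real.rpow_intCast,
        ← Real.rpow_mul hp.le, ← Real.rpow_mul hp.le]
      congr 1
      push_cast
      ring
    have hexp : s + d - j = s + ((d - j : ℕ) : ℝ) := by
      rw [Nat.cast_sub hj]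
      ring
    rw [homGen, if_neg hy, norm_mul, norm_mul, norm_zpow, norm_pow, norm_pow, norm_iotaL,
      norm_iotaL, hval, hexp, Real.rpow_add hy', Real.rpow_natCast]

lemma norm_affine_le (u v : ℚ_[p]) (z : ℤ_[p]) : ‖u + z * v‖ ≤ max ‖u‖ ‖v‖ := by
  refine (IsUltrametricDist.norm_add_le_max _ _).trans (max_le_max le_rfl ?_)
  rw [norm_mul]
  exact mul_le_of_le_one_left (norm_nonneg _) (PadicInt.norm_le_one z)

lemma isCr_homGen [IsUltrametricDist L] [CompleteSpace L] {r : ℝ} (hr : 0 < r) {d : ℕ}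
    (hrd : r < d + 1) {q : L} {s : ℝ} (hq : ‖q‖ = (p : ℝ) ^ (-s)) {j : ℕ} (hj : j ≤ d)
    (hs : r < s + d - j) (x₀ x₁ y₀ y₁ : ℚ_[p]) :
    IsCr p L r (fun z : ℤ_[p] ↦ homGen q d j (x₀ + (z : ℚ_[p]) * x₁) (y₀ + (z : ℚ_[p]) * y₁)) := by
  set σ := s + d - j with hσ
  have hσ0 : 0 < σ := hr.trans hs
  set R := max ‖x₀‖ ‖x₁‖ with hR
  have hR0 : 0 ≤ R := (norm_nonneg _).trans (le_max_left _ _)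
  have hp0 : 0 < (p : ℝ) := by exact_mod_cast (Fact.out : p.Prime).pos
  have hbound (z : ℤ_[p]) {T : ℝ} (hT : ‖y₀ + z * y₁‖ ≤ T) :
      ‖homGen q d j (x₀ + (z : ℚ_[p]) * x₁) (y₀ + (z : ℚ_[p]) * y₁)‖ ≤ T ^ σ * R ^ j := by
    refine (norm_homGen_le hq hj _ _).trans ?_
    refine mul_le_mul (Real.rpow_le_rpow (norm_nonneg _) hT hσ0.le)
      (pow_le_pow_left₀ (norm_nonneg _) (norm_affine_le _ _ _) _) (by positivity) ?_
    exact Real.rpow_nonneg ((norm_nonneg _).trans hT) _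
  refine isCr_of_approxOn hr hrd (fun z ↦ hbound z (norm_affine_le _ _ _)) fun ε hε ↦ ?_
  have ht : Tendsto (fun h : ℕ ↦ ‖y₁‖ ^ σ * R ^ j * ((p : ℝ) ^ (-(σ - r))) ^ h) atTop (𝓝 0) := by
    have := tendsto_pow_atTop_nhds_zero_of_lt_one (rpow_neg_prime_pos p (σ - r)).le
      (rpow_neg_prime_lt_one p (sub_pos.mpr hs))
    simpa using this.const_mul (‖y₁‖ ^ σ * R ^ j)
  filter_upwards [ht.eventually_le_const hε] with h hh a
  have hball {z : ℤ_[p]} (hz : ‖z - a‖ ≤ (p : ℝ)⁻¹ ^ h) :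
      ‖(y₀ + z * y₁) - (y₀ + a * y₁)‖ ≤ (p : ℝ)⁻¹ ^ h * ‖y₁‖ := by
    have h3 : (y₀ + z * y₁) - (y₀ + a * y₁) = ((z - a : ℤ_[p]) : ℚ_[p]) * y₁ := by
      rw [PadicInt.coe_sub]
      ring
    rw [h3, norm_mul]
    exact mul_le_mul_of_nonneg_right hz (norm_nonneg _)
  rcases lt_or_ge ((p : ℝ)⁻¹ ^ h * ‖y₁‖) ‖y₀ + a * y₁‖ with hlt | hge
  · have hlin (u v : L) : (Polynomial.C v * Polynomial.X + Polynomial.C u).natDegree ≤ 1 :=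
      Polynomial.natDegree_linear_le
    refine ⟨Polynomial.C (q ^ (y₀ + a * y₁).valuation) *
      ((Polynomial.C (iotaL p L y₁) * Polynomial.X + Polynomial.C (iotaL p L y₀)) ^ (d - j) *
      (Polynomial.C (iotaL p L x₁) * Polynomial.X + Polynomial.C (iotaL p L x₀)) ^ j), ?_, ?_⟩
    · refine (Polynomial.natDegree_C_mul_le _ _).trans (Polynomial.natDegree_mul_le.trans ?_)
      have h1 := Polynomial.natDegree_pow_le_of_le (d - j) (hlin (iotaL p L y₀) (iotaL p L y₁))
      have h2 := Polynomial.natDegree_pow_le_of_le j (hlin (iotaL p L x₀) (iotaL p L x₁))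
      lia
    · intro z hz
      have hnorm := norm_eq_of_norm_sub_lt ((hball hz).trans_lt hlt)
      have hz0 : y₀ + z * y₁ ≠ 0 := by
        rw [← norm_pos_iff, hnorm]
        exact lt_of_le_of_lt (by positivity) hlt
      have haff (u v : ℚ_[p]) : iotaL p L v * iotaL p L z + iotaL p L u =
          iotaL p L (u + z * v) := by
        simp [iotaL, add_comm, mul_comm]
      simp only [Polynomial.eval_mul, Polynomial.eval_C, Polynomial.eval_pow, Polynomial.eval_add,
        Polynomial.eval_X, haff]
      rw [homGen, if_neg hz0, valuation_eq_of_norm_eq hz0 hnorm, mul_assoc, sub_self, norm_zero]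
      exact mul_nonneg hε.le (pow_nonneg (rpow_neg_prime_pos p r).le _)
  · refine ⟨0, by simp, fun z hz ↦ ?_⟩
    rw [Polynomial.eval_zero, sub_zero]
    have hz' : ‖y₀ + z * y₁‖ ≤ (p : ℝ)⁻¹ ^ h * ‖y₁‖ := by
      rw [← sub_add_cancel (y₀ + z * y₁) (y₀ + a * y₁)]
      exact (IsUltrametricDist.norm_add_le_max _ _).trans (max_le (hball hz) hge)
    refine (hbound z hz').trans ?_
    have hpow : ((p : ℝ)⁻¹ ^ h) ^ σ = ((p : ℝ) ^ (-(σ - r))) ^ h * ((p : ℝ) ^ (-r)) ^ h := by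
      rw [← mul_pow, ← Real.rpow_add hp0, ← Real.rpow_natCast, ← Real.rpow_natCast,
        ← Real.rpow_neg_one, ← Real.rpow_mul hp0.le, ← Real.rpow_mul hp0.le,
        ← Real.rpow_mul hp0.le]
      congr 1
      ring
    rw [Real.mul_rpow (by positivity) (norm_nonneg _), hpow]
    calc ((p : ℝ) ^ (-(σ - r))) ^ h * ((p : ℝ) ^ (-r)) ^ h * ‖y₁‖ ^ σ * R ^ j
        = ‖y₁‖ ^ σ * R ^ j * ((p : ℝ) ^ (-(σ - r))) ^ h * ((p : ℝ) ^ (-r)) ^ h := by ring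
      _ ≤ _ := mul_le_mul_of_nonneg_right hh (pow_nonneg (rpow_neg_prime_pos p r).le _)

variable {k : ℕ} {α β : L}

lemma monomialFun_eq_homGen (q : L) (d j : ℕ) :
    monomialFun p L j = fun z ↦ homGen q d j z 1 := by
  funext z
  simp [monomialFun, homGen, iotaL]

lemma specFun_eq_homGen (a : ℚ_[p]) (j : ℕ) :
    specFun p L k α β a j = fun z ↦ homGen (α * (p : L) / β) (k - 2) j 1 (z - a * 1) := by
  funext z
  simp [specFun, homGen, sub_eq_zero, iotaL]

/-- Pulling back `homGen` along an affine line stays in the span of the generators of `L(α)`. -/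
lemma homGen_affine_mem_span (hq : α * (p : L) / β ≠ 0) {j : ℕ} (hj : (j : ℝ) < valL p L α)
    (hjk : j ≤ k - 2) (s t u w : ℚ_[p]) :
    (fun z ↦ homGen (α * (p : L) / β) (k - 2) j (s * z + t) (u * z + w)) ∈
      Submodule.span L (lGen p L k α β) := by
  set q := α * (p : L) / β with hqdef
  by_cases hu : u = 0
  · by_cases hw : w = 0
    · have h0 : (fun z ↦ homGen q (k - 2) j (s * z + t) (u * z + w)) = 0 := by
        funext z
        simp [homGen, hu, hw]
      rw [h0]
      exact Submodule.zero_mem _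
    · have hsum : (fun z ↦ homGen q (k - 2) j (s * z + t) (u * z + w)) =
          ∑ i ∈ Finset.range (j + 1), (q ^ w.valuation * iotaL p L w ^ (k - 2 - j) *
            iotaL p L s ^ i * iotaL p L t ^ (j - i) * (j.choose i : L)) • monomialFun p L i := by
        funext z
        have haff : iotaL p L (s * z + t) = iotaL p L s * iotaL p L z + iotaL p L t := by
          simp [iotaL]
        rw [homGen, hu, zero_mul, zero_add, if_neg hw, haff, add_pow, Finset.mul_sum,
          Finset.sum_apply]
        refine Finset.sum_congr rfl fun i _ ↦ ?_
        rw [Pi.smul_apply, monomialFun, smul_eq_mul, mul_pow]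
        ring
      rw [hsum]
      refine Submodule.sum_mem _ fun i hi ↦ Submodule.smul_mem _ _ (Submodule.subset_span ?_)
      refine ⟨i, lt_of_le_of_lt ?_ hj, Or.inl rfl⟩
      exact_mod_cast Nat.lt_succ_iff.mp (Finset.mem_range.mp hi)
  · set a := -w / u with ha
    have hua (z : ℚ_[p]) : u * z + w = u * (z - a) := by
      rw [ha]
      field_simp
      ring
    have hsum : (fun z ↦ homGen q (k - 2) j (s * z + t) (u * z + w)) =
        ∑ i ∈ Finset.range (j + 1), (q ^ u.valuation * iotaL p L u ^ (k - 2 - j) *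
          iotaL p L s ^ i * iotaL p L (s * a + t) ^ (j - i) * (j.choose i : L)) •
            specFun p L k α β a (j - i) := by
      funext z
      rw [Finset.sum_apply, hua]
      by_cases hz : z = a
      · simp [homGen, specFun, hz]
      · have hz' : z - a ≠ 0 := sub_ne_zero.mpr hz
        have haff : iotaL p L (s * z + t) =
            iotaL p L s * iotaL p L (z - a) + iotaL p L (s * a + t) := by
          simp only [iotaL, ← map_mul, ← map_add]
          congr 1
          ring
        rw [homGen, if_neg (mul_ne_zero hu hz'), haff, add_pow, Finset.mul_sum,
          Padic.valuation_mul hu hz', zpow_add₀ hq]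
        refine Finset.sum_congr rfl fun i hi ↦ ?_
        have hi' : i ≤ j := Nat.lt_succ_iff.mp (Finset.mem_range.mp hi)
        have hexp : k - 2 - (j - i) = (k - 2 - j) + i := by lia
        have hmul : iotaL p L (u * (z - a)) = iotaL p L u * iotaL p L (z - a) := by
          simp only [iotaL, map_mul]
        rw [Pi.smul_apply, specFun, if_neg hz, smul_eq_mul, hexp, pow_add, hmul, mul_pow, mul_pow]
        ring
    rw [hsum]
    refine Submodule.sum_mem _ fun i hi ↦ Submodule.smul_mem _ _ (Submodule.subset_span ?_)
    refine ⟨j - i, lt_of_le_of_lt ?_ hj, Or.inr ⟨a, rfl⟩⟩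
    exact_mod_cast Nat.sub_le j i

variable [IsUltrametricDist L] [CompleteSpace L]

/-- The generators of `L(α)` lie in `B(α)`, and `GL₂(ℚ_p)` maps them to their span. -/
lemma memB_and_gAct_mem_span (hk : 2 ≤ k) (hα : 0 < valL p L α) (hβ : 0 < valL p L β)
    (hαβ : valL p L α + valL p L β = (k : ℝ) - 1) {f : ℚ_[p] → L} (hf : f ∈ lGen p L k α β) :
    MemB p L k α β f ∧ ∀ m : Matrix (Fin 2) (Fin 2) ℚ_[p], det2 p m ≠ 0 →
      gAct p L k α β m f ∈ Submodule.span L (lGen p L k α β) := by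
  have hα0 := ne_zero_of_valL_pos hα
  have hβ0 := ne_zero_of_valL_pos hβ
  have hpn : ‖(p : L)‖ = (p : ℝ)⁻¹ := norm_natCast_prime
  have hp : 0 < (p : ℝ) := by exact_mod_cast (Fact.out : p.Prime).pos
  have hpL : (p : L) ≠ 0 := by
    rw [← norm_pos_iff, hpn]
    exact prime_inv_pos p
  have hq : α * (p : L) / β ≠ 0 := div_ne_zero (mul_ne_zero hα0 hpL) hβ0
  have hcast : ((k - 2 : ℕ) : ℝ) = k - 2 := by
    rw [Nat.cast_sub hk]
    norm_num
  have hrd : valL p L α < ((k - 2 : ℕ) : ℝ) + 1 := by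
    rw [hcast]
    linarith
  have hqn : ‖α * (p : L) / β‖ = (p : ℝ) ^ (-(valL p L α + 1 - valL p L β)) := by
    rw [norm_div, norm_mul, hpn, norm_eq_rpow_neg_valL (p := p) hα0,
      norm_eq_rpow_neg_valL (p := p) hβ0, ← Real.rpow_neg_one, ← Real.rpow_add hp,
      ← Real.rpow_sub hp]
    congr 1
    ring
  obtain ⟨j, hj, hf⟩ := hf
  have hjk : j ≤ k - 2 := by
    have h1 : (j : ℝ) < ((k - 2 : ℕ) : ℝ) + 1 := hj.trans hrd
    exact Nat.lt_succ_iff.mp (by exact_mod_cast h1)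
  have hs : valL p L α < valL p L α + 1 - valL p L β + ((k - 2 : ℕ) : ℝ) - j := by
    rw [hcast]
    linarith
  have hCr := isCr_homGen (p := p) (L := L) hα hrd hqn hjk hs
  set q := α * (p : L) / β with hqdef
  have key (F : ℚ_[p] → ℚ_[p] → L) (hF : IsHomog q (k - 2) F)
      (h1 : IsCr p L (valL p L α) (fun z : ℤ_[p] ↦ F (p * z) 1))
      (h2 : IsCr p L (valL p L α) (fun z : ℤ_[p] ↦ F 1 z))
      (h3 : ∀ a b c d : ℚ_[p], (fun z ↦ F (d * z - b) (-c * z + a)) ∈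
        Submodule.span L (lGen p L k α β)) :
      MemB p L k α β (fun z ↦ F z 1) ∧ ∀ m : Matrix (Fin 2) (Fin 2) ℚ_[p], det2 p m ≠ 0 →
        gAct p L k α β m (fun z ↦ F z 1) ∈ Submodule.span L (lGen p L k α β) := by
    refine ⟨⟨h1, _, hF.ext2 h2⟩, fun m hm ↦ ?_⟩
    have h4 : gAct p L k α β m (fun z ↦ F z 1) = α ^ (-(det2 p m).valuation) •
        fun z ↦ F (m 1 1 * z - m 0 1) (-(m 1 0) * z + m 0 0) := by
      funext z
      have h5 := adjugate_ne_zero hm (x := z) (y := 1) (Or.inr one_ne_zero)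
      rw [mul_one, mul_one] at h5
      rw [gAct_eq_homFun hm, homFun_eq hα hF h2 h5, Pi.smul_apply, smul_eq_mul]
    rw [h4]
    exact Submodule.smul_mem _ _ (h3 _ _ _ _)
  rcases hf with rfl | ⟨a₀, rfl⟩
  · rw [monomialFun_eq_homGen q (k - 2) j]
    refine key (homGen q (k - 2) j) (fun t x y ht _ ↦ homGen_mul hq hjk ht x y) ?_ ?_
      fun a b c d ↦ ?_
    · simpa [mul_comm] using hCr 0 p 1 0
    · simpa using hCr 1 0 0 1
    · simpa [sub_eq_add_neg] using homGen_affine_mem_span hq hj hjk d (-b) (-c) a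
  · rw [specFun_eq_homGen]
    refine key (fun x y ↦ homGen q (k - 2) j y (x - a₀ * y)) (fun t x y ht _ ↦ ?_) ?_ ?_
      fun a b c d ↦ ?_
    · rw [← homGen_mul hq hjk ht, mul_sub, mul_left_comm]
    · simpa [mul_comm, sub_eq_add_neg, add_comm] using hCr 1 0 (-a₀) p
    · simpa [mul_comm, sub_eq_add_neg] using hCr 0 1 1 (-a₀)
    · convert homGen_affine_mem_span hq hj hjk (-c) a (d + a₀ * c) (-b - a₀ * a) using 3
      ring

/-- `L(α)` is stable under the action of `GL₂(ℚ_p)`. -/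
lemma MemLalpha.gAct (hk : 2 ≤ k) (hα : 0 < valL p L α) (hβ : 0 < valL p L β)
    (hαβ : valL p L α + valL p L β = (k : ℝ) - 1) {m : Matrix (Fin 2) (Fin 2) ℚ_[p]}
    (hm : det2 p m ≠ 0) {f : ℚ_[p] → L} (hf : MemLalpha p L k α β f) :
    MemLalpha p L k α β (gAct p L k α β m f) := by
  have hrd : valL p L α < ((k - 2 : ℕ) : ℝ) + 1 := by
    rw [Nat.cast_sub hk]
    push_cast
    linarith
  obtain ⟨K, hK, hB⟩ := exists_bNorm_gAct_le (ne_zero_of_valL_pos hα) (ne_zero_of_valL_pos hβ)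
    hα hrd hm
  have hspan : ∀ g ∈ Submodule.span L (lGen p L k α β), MemB p L k α β g ∧
      Paper.gAct p L k α β m g ∈ Submodule.span L (lGen p L k α β) := by
    intro g hg
    induction hg using Submodule.span_induction with
    | mem g hg =>
      have := memB_and_gAct_mem_span hk hα hβ hαβ hg
      exact ⟨this.1, this.2 m hm⟩
    | zero =>
      have h0 := gAct_smul hα 0 (memB_zero (k := k) (β := β)) m
      rw [zero_smul, zero_smul] at h0
      refine ⟨memB_zero, ?_⟩
      rw [h0]
      exact Submodule.zero_mem _
    | add g g' _ _ h h' =>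
      refine ⟨h.1.add h'.1, ?_⟩
      rw [gAct_add hα h.1 h'.1]
      exact Submodule.add_mem _ h.2 h'.2
    | smul c g _ h =>
      refine ⟨h.1.smul c, ?_⟩
      rw [gAct_smul hα c h.1]
      exact Submodule.smul_mem _ _ h.2
  refine ⟨(hB f hf.1).1, fun ε hε ↦ ?_⟩
  obtain ⟨g, hg, hfg⟩ := hf.2 (ε / K) (div_pos hε hK)
  obtain ⟨hgB, hgS⟩ := hspan g hg
  refine ⟨_, hgS, ?_⟩
  have hsub : f - g = f + (-1 : L) • g := by rw [neg_one_smul, sub_eq_add_neg]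
  have hact : Paper.gAct p L k α β m f - Paper.gAct p L k α β m g =
      Paper.gAct p L k α β m (f - g) := by
    rw [hsub, gAct_add hα hf.1 (hgB.smul _), gAct_smul hα _ hgB, neg_one_smul, sub_eq_add_neg]
  rw [hact]
  have hle := (hB (f - g) (by rw [hsub]; exact hf.1.add (hgB.smul _))).2
  refine hle.trans_lt ?_
  rwa [lt_div_iff₀ hK, mul_comm] at hfg

end Generators

/-- The closed subspace `L(α)` of `B(α)` is stable under the `GL₂(ℚ_p)`-action;
likewise `L(β) ⊆ B(β)`. -/
theorem statement7 (p : ℕ) [Fact p.Prime] (L : Type) [NontriviallyNormedField L]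
    [NormedAlgebra ℚ_[p] L] [FiniteDimensional ℚ_[p] L] [IsUltrametricDist L]
    (k : ℕ) (α β : L) (h : Hyps p L k α β) :
    (∀ m : Matrix (Fin 2) (Fin 2) ℚ_[p], det2 p m ≠ 0 →
      ∀ f : ℚ_[p] → L, MemLalpha p L k α β f → MemLalpha p L k α β (gAct p L k α β m f)) ∧
    (∀ m : Matrix (Fin 2) (Fin 2) ℚ_[p], det2 p m ≠ 0 →
      ∀ f : ℚ_[p] → L, MemLalpha p L k β α f → MemLalpha p L k β α (gAct p L k β α m f)) := by
  obtain ⟨hk, -, hα, hβ, hαβ, -⟩ := h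
  have : CompleteSpace L := FiniteDimensional.complete ℚ_[p] L
  exact ⟨fun m hm f hf ↦ hf.gAct hk hα hβ hαβ hm,
    fun m hm f hf ↦ hf.gAct hk hβ hα (by rwa [add_comm]) hm⟩

end Paper

end
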